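/- arXiv:2011.10791 — 4 statements merged into one kernel-verified Lean document; each statement's English description precedes it below -/
import Mathlib

section
/- Let t ≥ s ≥ 2 with t ≥ 3 be integers. Let G be a bipartite graph with S ⊆ X and let {C_1, C_2} be a minimal system of two disjoint feasible cycles with |S ∩ V(C_1)| = t and |S ∩ V(C_2)| = s. Then the number of edges from (S ∩ V(C_1)) ∪ (S ∩ V(C_1))^+ to V(C_2) is at most (t/2)·|C_2|, where (S ∩ V(C_1))^+ denotes the set of successors on C_1 of the S-vertices of C_1. -/
namespace TwoCycles

/-- Kinds of vertices of the second cycle: arbitrary, in `X`, in `Y`, or in `S`. -/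
inductive Kind
  | any | xx | yy | ss

/-- `c.fits d` says that every vertex of kind `d` is also of kind `c`. -/
def Kind.fits : Kind → Kind → Bool
  | .any, _ => true
  | .xx, .xx => true
  | .xx, .ss => true
  | .yy, .yy => true
  | .ss, .ss => true
  | _, _ => false

theorem Kind.fits_trans {a b c : Kind} (hab : a.fits b) (hbc : b.fits c) : a.fits c := by
  cases a <;> cases b <;> cases c <;> simp_all [Kind.fits]

/-- A pattern is a word of vertex kinds, each with a set of labels, encoded as a bit mask, that the
vertex has to carry. -/
abbrev Pattern := List (Kind × ℕ)

/-- The permutations of the three labels `1`, `2`, `4`. -/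
def labelPerms : List (ℕ × ℕ × ℕ) :=
  [(1, 2, 4), (1, 4, 2), (2, 1, 4), (2, 4, 1), (4, 1, 2), (4, 2, 1)]

/-- Patterns which, occurring on the second cycle, allow to find a smaller system. -/
def basePatterns : ℕ × ℕ × ℕ → List Pattern
  | (i, j, k) =>
    [[(.yy, i + j), (.ss, i + j), (.any, 0)],
     [(.xx, j + k), (.yy, i), (.ss, 0), (.yy, i), (.any, 0)],
     [(.xx, i), (.yy, i), (.yy, j), (.ss, 0), (.yy, j)],
     [(.xx, i), (.yy, i), (.xx, k), (.ss, 0), (.yy, j), (.any, 0)],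
     [(.yy, i + j), (.ss, i), (.ss, i)],
     [(.yy, k), (.xx, k), (.ss, i), (.ss, i)],
     [(.ss, i + j), (.yy, i), (.ss, 0), (.yy, i)],
     [(.yy, i), (.ss, j), (.ss, i + k)],
     [(.ss, j), (.yy, k), (.yy, i + j)]]

def rotations (p : Pattern) : List Pattern :=
  (List.range p.length).map fun r => p.drop r ++ p.take r

/-- All images of the base patterns under rotation and reversal. -/
def patterns : List Pattern :=
  (labelPerms.flatMap basePatterns).flatMap fun p => rotations p ++ rotations p.reverse

/-- The ways of cutting `p ++ q` into a matched prefix, containing `p`, and a remaining suffix. -/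
def cuts : Pattern → Pattern → List (Pattern × Pattern)
  | p, [] => [(p, [])]
  | p, a :: q => (p, a :: q) :: cuts (p ++ [a]) q

/-- The states of the automaton looking for an occurrence of a pattern. -/
def states : List (Pattern × Pattern) := patterns.flatMap (cuts [])

/-- The bit mask of the set of positions of `l` at which `f` holds. -/
def bits {α : Type*} (f : α → Bool) : List α → ℕ
  | [] => 0
  | a :: l => Nat.add (Nat.mul 2 (bits f l)) (f a).toNat

/-- The states in which nothing has been read. -/
def startBits : ℕ := bits (fun st => st.1.isEmpty) states

/-- The states in which a whole pattern has been read. -/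
def finalBits : ℕ := bits (fun st => st.2.isEmpty) states

/-- The states in which a vertex of kind `c` may be read. -/
def kindBits (c : Kind) : ℕ :=
  bits (fun st => match st.2 with | [] => false | a :: _ => a.1.fits c) states

/-- The states in which a vertex with label set `l` may be read. -/
def labelBits (l : ℕ) : ℕ :=
  bits (fun st => match st.2 with | [] => false | a :: _ => Nat.beq (Nat.land a.2 l) a.2) states

/-- The number of labels in a label set. -/
def weight (l : ℕ) : ℕ := l % 2 + l / 2 % 2 + l / 4

/-- All label sets, each with its number of labels and the number of missing labels. -/
def labelSets : List (ℕ × ℕ × ℕ) :=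
  [(0, 0, 3), (1, 1, 2), (2, 1, 2), (3, 2, 1), (4, 1, 2), (5, 2, 1), (6, 2, 1), (7, 3, 0)]

/-- One step of `search`: all label sets of the next letter are tried, and `k` is called with the
remaining letters. -/
def searchStep (c : Kind × Bool) (k : ℕ → ℕ → ℕ → Bool) (prev d s : ℕ) : Bool :=
  !(Nat.beq (Nat.land s finalBits) 0) || labelSets.all fun l =>
    (c.2 && Nat.blt (Nat.add prev l.2.1) 4) || Nat.blt d l.2.2 ||
      k l.2.1 (Nat.sub d l.2.2)
        (Nat.lor s (Nat.mul 2 (Nat.land s (Nat.land (kindBits c.1) (labelBits l.1)))))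

/-- `search w prev d s` checks that in each labelling of the word `w` with at most `d` missing
labels a pattern occurs. A letter of `w` marked `true` is known to carry at least four labels
together with its predecessor. -/
def search (w : List (Kind × Bool)) : ℕ → ℕ → ℕ → Bool :=
  w.foldr searchStep fun _ _ s => !(Nat.beq (Nat.land s finalBits) 0)

theorem testBit_bits {α : Type*} (f : α → Bool) (l : List α) (n : ℕ) :
    (bits f l).testBit n = true ↔ ∃ a, l[n]? = some a ∧ f a = true := by
  induction l generalizing n with
  | nil => simp [bits]
  | cons a l ih =>
    have h : bits f (a :: l) = 2 * bits f l + (f a).toNat := rfl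
    rw [h]
    cases n with
    | zero => cases hf : f a <;> simp [hf]
    | succ n =>
      rw [Nat.testBit_succ]
      have : (2 * bits f l + (f a).toNat) / 2 = bits f l := by
        cases f a <;> simp; omega
      rw [this, ih]
      simp

theorem cuts_succ (q : Pattern) : ∀ (p p' q' : Pattern) (a : Kind × ℕ) (n : ℕ),
    (cuts p q)[n]? = some (p', a :: q') → (cuts p q)[n + 1]? = some (p' ++ [a], q') := by
  induction q with
  | nil =>
    intro p p' q' a n h
    cases n <;> simp [cuts] at h
  | cons b q ih =>
    intro p p' q' a n h
    cases n with
    | zero =>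
      simp only [cuts, List.getElem?_cons_zero, Option.some.injEq, Prod.mk.injEq,
        List.cons.injEq] at h
      obtain ⟨rfl, rfl, rfl⟩ := h
      cases q <;> simp [cuts]
    | succ n =>
      simp only [cuts, List.getElem?_cons_succ] at h ⊢
      exact ih _ _ _ _ _ h

theorem flatMap_cuts_succ (P : List Pattern) (p q : Pattern) (a : Kind × ℕ) (n : ℕ)
    (h : (P.flatMap (cuts []))[n]? = some (p, a :: q)) :
    (P.flatMap (cuts []))[n + 1]? = some (p ++ [a], q) := by
  induction P generalizing n with
  | nil => simp at h
  | cons r P ih =>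
    rw [List.flatMap_cons] at h ⊢
    rcases lt_or_ge n (cuts [] r).length with hn | hn
    · rw [List.getElem?_append_left hn] at h
      have h' := cuts_succ _ _ _ _ _ _ h
      obtain ⟨hn', -⟩ := List.getElem?_eq_some_iff.1 h'
      rwa [List.getElem?_append_left hn']
    · rw [List.getElem?_append_right hn] at h
      rw [List.getElem?_append_right (by omega), Nat.sub_add_comm hn]
      exact ih _ h

theorem append_eq_of_mem_cuts (q : Pattern) : ∀ (p : Pattern) (st : Pattern × Pattern),
    st ∈ cuts p q → st.1 ++ st.2 = p ++ q := by
  induction q with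
  | nil => intro p st h; simp_all [cuts]
  | cons a q ih =>
    intro p st h
    rcases List.mem_cons.1 h with rfl | h
    · rfl
    · simpa using ih _ _ h

theorem append_mem_patterns {st : Pattern × Pattern} (h : st ∈ states) :
    st.1 ++ st.2 ∈ patterns := by
  obtain ⟨p, hp, h⟩ := List.mem_flatMap.1 h
  rw [append_eq_of_mem_cuts _ _ _ h]
  exact hp

section Search

variable {V : Type*} (kd : V → Kind) (lab : V → ℕ)

/-- The vertex `v` satisfies the letter `a` of a pattern. -/
def Fits (a : Kind × ℕ) (v : V) : Prop :=
  a.1.fits (kd v) = true ∧ Nat.land a.2 (lab v) = a.2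

/-- The number of missing labels. -/
def loss (v : V) : ℕ := 3 - weight (lab v)

/-- The marked letters of a word, together with their predecessors, carry four labels. -/
def Marked : List (Kind × Bool) → ℕ → List V → Prop
  | c :: w, prev, v :: vs => (c.2 = true → 4 ≤ prev + weight (lab v)) ∧ Marked w (weight (lab v)) vs
  | _, _, _ => True

/-- The automaton is in state `s` only if the corresponding prefixes of patterns were read. -/
def Tracks (s : ℕ) (vs : List V) : Prop :=
  ∀ n st, states[n]? = some st → s.testBit n = true →
    ∃ ws, ws.Sublist vs ∧ List.Forall₂ (Fits kd lab) st.1 ws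

variable {kd lab}

theorem tracks_start : Tracks kd lab startBits [] := by
  intro n st hst hn
  obtain ⟨st', hst', he⟩ := (testBit_bits _ _ _).1 hn
  rw [hst] at hst'
  cases hst'
  rw [List.isEmpty_iff] at he
  rw [he]
  exact ⟨[], List.Sublist.refl _, .nil⟩

theorem Tracks.step {s : ℕ} {vs : List V} (h : Tracks kd lab s vs) {c : Kind} {v : V}
    (hc : c.fits (kd v) = true) :
    Tracks kd lab (Nat.lor s (Nat.mul 2 (Nat.land s
      (Nat.land (kindBits c) (labelBits (lab v)))))) (vs ++ [v]) := by
  intro n st hst hn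
  change (s ||| 2 * (s &&& (kindBits c &&& labelBits (lab v)))).testBit n = true at hn
  rw [Nat.testBit_or, Bool.or_eq_true] at hn
  rcases hn with hn | hn
  · obtain ⟨ws, hws, hf⟩ := h n st hst hn
    exact ⟨ws, hws.trans (List.sublist_append_left _ _), hf⟩
  · cases n with
    | zero => simp at hn
    | succ n =>
      rw [Nat.testBit_succ, Nat.mul_div_cancel_left _ two_pos, Nat.testBit_and, Nat.testBit_and,
        Bool.and_eq_true, Bool.and_eq_true] at hn
      obtain ⟨hs, hk, hl⟩ := hn
      obtain ⟨⟨p, q⟩, hst₁, hk⟩ := (testBit_bits _ _ _).1 hk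
      obtain ⟨st₂, hst₂, hl⟩ := (testBit_bits _ _ _).1 hl
      rw [hst₁] at hst₂
      cases hst₂
      cases q with
      | nil => simp at hk
      | cons a q =>
        have hsucc := flatMap_cuts_succ _ _ _ _ _ hst₁
        change states[n + 1]? = _ at hsucc
        rw [hst] at hsucc
        cases hsucc
        obtain ⟨ws, hws, hf⟩ := h n _ hst₁ hs
        refine ⟨ws ++ [v], hws.append (List.Sublist.refl _), List.rel_append hf ?_⟩
        exact .cons ⟨Kind.fits_trans hk hc, Nat.eq_of_beq_eq_true hl⟩ .nil

theorem Tracks.final {s : ℕ} {vs : List V} (h : Tracks kd lab s vs)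
    (hs : (!(Nat.beq (Nat.land s finalBits) 0)) = true) :
    ∃ p ∈ patterns, ∃ ws, ws.Sublist vs ∧ List.Forall₂ (Fits kd lab) p ws := by
  have hne : s &&& finalBits ≠ 0 := by
    intro h0
    change (!(Nat.beq (s &&& finalBits) 0)) = true at hs
    rw [h0] at hs
    simp at hs
  obtain ⟨n, hn⟩ := Nat.exists_testBit_of_ne_zero hne
  rw [Nat.testBit_and, Bool.and_eq_true] at hn
  obtain ⟨st, hst, he⟩ := (testBit_bits _ _ _).1 hn.2
  obtain ⟨ws, hws, hf⟩ := h n st hst hn.1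
  have hmem := append_mem_patterns (List.mem_of_getElem? hst)
  rw [List.isEmpty_iff.1 he, List.append_nil] at hmem
  exact ⟨_, hmem, ws, hws, hf⟩

theorem mem_labelSets : ∀ l < 8, (l, weight l, 3 - weight l) ∈ labelSets := by decide

theorem search_sound (hlab : ∀ v, lab v < 8) {W : List V}
    (hW : ∀ p ∈ patterns, ∀ ws, ws.Sublist W → ¬ List.Forall₂ (Fits kd lab) p ws) :
    ∀ (w : List (Kind × Bool)) (vs us : List V) (prev d s : ℕ), search w prev d s = true →
      List.Forall₂ (fun c v => c.1.fits (kd v) = true) w vs → Marked lab w prev vs →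
      Tracks kd lab s us → (us ++ vs).Sublist W → d < (vs.map (loss lab)).sum := by
  intro w
  have hfin : ∀ us s, Tracks kd lab s us → us.Sublist W →
      (!(Nat.beq (Nat.land s finalBits) 0)) = true → False := by
    intro us s ht hus hs
    obtain ⟨p, hp, ws, hws, hf⟩ := ht.final hs
    exact hW p hp ws (hws.trans hus) hf
  induction w with
  | nil =>
    intro vs us prev d s hs _ _ ht hus
    exact (hfin us s ht ((List.sublist_append_left _ _).trans hus) hs).elim
  | cons c w ih =>
    intro vs us prev d s hs hfits hm ht hus
    cases hfits with
    | @cons _ v _ vs hc hfits =>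
    rcases Bool.or_eq_true_iff.1 (show searchStep c (search w) prev d s = true from hs)
      with hs | hs
    · exact (hfin us s ht ((List.sublist_append_left _ _).trans hus) hs).elim
    · have hs := List.all_eq_true.1 hs _ (mem_labelSets _ (hlab v))
      simp only [Bool.or_eq_true, Bool.and_eq_true] at hs
      simp only [List.map_cons, List.sum_cons]
      change _ < 3 - weight (lab v) + _
      rcases hs with (⟨hc2, hlt⟩ | hlt) | hs
      · have h4 := hm.1 hc2
        have : prev + weight (lab v) < 4 := by simpa [Nat.blt] using hlt
        omega
      · have : d < 3 - weight (lab v) := by simpa [Nat.blt] using hlt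
        omega
      · have := ih vs (us ++ [v]) _ _ _ hs hfits hm.2 (ht.step hc) (by simpa using hus)
        change d - (3 - weight (lab v)) < _ at this
        omega

end Search

set_option maxRecDepth 100000 in
theorem search_one_one : search [(.ss, false), (.yy, false), (.ss, false), (.yy, false)]
    0 5 startBits = true := by
  decide +kernel

set_option maxRecDepth 100000 in
theorem search_three_one : search [(.ss, false), (.yy, false), (.xx, true), (.yy, true),
    (.ss, false), (.yy, false)] 0 8 startBits = true := by
  decide +kernel

set_option maxRecDepth 100000 in
theorem search_five_one : search [(.ss, false), (.yy, false), (.xx, true), (.yy, true),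
    (.xx, true), (.yy, true), (.ss, false), (.yy, false)] 0 11 startBits = true := by
  decide +kernel

set_option maxRecDepth 100000 in
theorem search_three_three : search [(.ss, false), (.yy, false), (.xx, true), (.yy, true),
    (.ss, false), (.yy, false), (.xx, true), (.yy, true)] 0 11 startBits = true := by
  decide +kernel

set_option maxRecDepth 100000 in
theorem search_seven : search [(.ss, false), (.yy, false), (.xx, true), (.yy, true),
    (.xx, true), (.yy, true), (.xx, true), (.yy, true), (.ss, false)] 0 27 startBits = true := by
  decide +kernel

set_option maxRecDepth 100000 in
theorem search_five_two : search [(.ss, false), (.yy, false), (.xx, true), (.yy, true),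
    (.xx, true), (.yy, true), (.ss, false), (.yy, false), (.xx, true)] 0 27 startBits = true := by
  decide +kernel

section Induction

variable {V : Type*} {kd : V → Kind} {lab : V → ℕ}

/-- A property of words which only depends on the cyclic word, up to reversal, and which passes to
subwords. -/
structure Cyclic (R : List V → Prop) : Prop where
  sublist : ∀ {l l'}, l.Sublist l' → R l' → R l
  rotate : ∀ {l l'}, R (l ++ l') → R (l' ++ l)
  reverse : ∀ {l}, R l → R l.reverse

theorem Cyclic.not_forall₂ {R : List V → Prop} (hR : Cyclic R)
    (hbase : ∀ t ∈ labelPerms, ∀ p ∈ basePatterns t, ∀ ws, R ws → ¬ List.Forall₂ (Fits kd lab) p ws)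
    {p : Pattern} (hp : p ∈ patterns) {ws : List V} (hws : R ws) :
    ¬ List.Forall₂ (Fits kd lab) p ws := by
  have hrot : ∀ q : Pattern, (∀ ws, R ws → ¬ List.Forall₂ (Fits kd lab) q ws) →
      ∀ p ∈ rotations q, ∀ ws, R ws → ¬ List.Forall₂ (Fits kd lab) p ws := by
    intro q hq p hp ws hws hf
    obtain ⟨r, -, rfl⟩ := List.mem_map.1 hp
    have h₁ := (List.forall₂_take_append _ _ _ hf.flip).flip
    have h₂ := (List.forall₂_drop_append _ _ _ hf.flip).flip
    refine hq _ (hR.rotate (l := ws.take (q.drop r).length) (by rwa [List.take_append_drop])) ?_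
    have := List.rel_append h₂ h₁
    dsimp only at this
    rwa [List.take_append_drop] at this
  obtain ⟨q, hq, hp⟩ := List.mem_flatMap.1 hp
  obtain ⟨t, ht, hq⟩ := List.mem_flatMap.1 hq
  rcases List.mem_append.1 hp with hp | hp
  · exact hrot q (hbase t ht q hq) p hp ws hws
  · refine hrot q.reverse (fun ws hws hf => ?_) p hp ws hws
    refine hbase t ht q hq _ (hR.reverse hws) ?_
    rwa [← List.forall₂_reverse_iff, List.reverse_reverse]

/-- Words of vertices alternating between `Y` and `X`, with both ends in `Y`. -/
inductive Alternating (kd : V → Kind) : List V → Prop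
  | single {y : V} (hy : kd y = .yy) : Alternating kd [y]
  | cons {y x : V} {M : List V} (hy : kd y = .yy) (hx : Kind.fits .xx (kd x) = true)
      (hM : Alternating kd M) : Alternating kd (y :: x :: M)

/-- Adjacent letters of the word carry together at least four labels. -/
def Heavy (lab : V → ℕ) (M : List V) : Prop :=
  M.IsChain fun a b => 4 ≤ weight (lab a) + weight (lab b)

/-- The total number of missing labels. -/
def totalLoss (lab : V → ℕ) (M : List V) : ℕ := (M.map (loss lab)).sum

theorem totalLoss_append (M L : List V) :
    totalLoss lab (M ++ L) = totalLoss lab M + totalLoss lab L := by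
  simp [totalLoss]

theorem totalLoss_cons (a : V) (L : List V) :
    totalLoss lab (a :: L) = loss lab a + totalLoss lab L := by
  simp [totalLoss]

theorem totalLoss_le (M : List V) : totalLoss lab M ≤ 3 * M.length := by
  induction M with
  | nil => simp [totalLoss]
  | cons a M ih =>
    rw [totalLoss_cons, List.length_cons]
    unfold loss
    omega

theorem Alternating.heavy_or {M : List V} (hM : Alternating kd M) :
    Heavy lab M ∨ ∃ M', Alternating kd M' ∧ M'.Sublist M ∧ M'.length + 2 = M.length ∧
      totalLoss lab M' + 3 ≤ totalLoss lab M := by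
  induction hM with
  | single hy => exact .inl (.singleton _)
  | @cons y x M hy hx hM ih =>
    by_cases h₁ : 4 ≤ weight (lab y) + weight (lab x)
    swap
    · refine .inr ⟨M, hM, by simp, by simp, ?_⟩
      simp only [totalLoss_cons, loss]
      omega
    rcases ih with ih | ⟨M', hM', hsub, hlen, hloss⟩
    swap
    · refine .inr ⟨y :: x :: M', .cons hy hx hM', (hsub.cons_cons _).cons_cons _,
        by simp; omega, ?_⟩
      simp only [totalLoss_cons]
      omega
    have key : ∀ z T, M = z :: T → Alternating kd (y :: T) → 
        Heavy lab (y :: x :: M) ∨ ∃ M', Alternating kd M' ∧ M'.Sublist (y :: x :: M) ∧ 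
        M'.length + 2 = (y :: x :: M).length ∧
        totalLoss lab M' + 3 ≤ totalLoss lab (y :: x :: M) := by
      rintro z T rfl hT
      by_cases h₂ : 4 ≤ weight (lab x) + weight (lab z)
      · exact .inl (.cons_cons h₁ (.cons_cons h₂ ih))
      · refine .inr ⟨y :: T, hT, by simp, by simp, ?_⟩
        simp only [totalLoss_cons, loss]
        omega
    cases hM with
    | single _ => exact key _ _ rfl (.single hy)
    | cons _ hx' hM => exact key _ _ rfl (.cons hy hx' hM)

theorem Alternating.cases {M : List V} (hM : Alternating kd M) :
    (∃ y, M = [y] ∧ kd y = .yy) ∨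
      ∃ y x M', M = y :: x :: M' ∧ kd y = .yy ∧ Kind.fits .xx (kd x) = true ∧
        Alternating kd M' := by
  cases hM with
  | single hy => exact .inl ⟨_, rfl, hy⟩
  | cons hy hx hM => exact .inr ⟨_, _, _, rfl, hy, hx, hM⟩

theorem three_mul_length_le_of_heavy (hlab : ∀ v, lab v < 8) {R : List V → Prop} (hR : Cyclic R)
    (hbase : ∀ t ∈ labelPerms, ∀ p ∈ basePatterns t, ∀ ws, R ws → ¬ List.Forall₂ (Fits kd lab) p ws)
    {p p' : V} {M L : List V} (hp' : kd p' = .ss) (hp : kd p = .ss) (hM : Alternating kd M)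
    (hL : Alternating kd L) (hhM : Heavy lab M) (hhL : Heavy lab L) (hle : L.length ≤ M.length)
    (h : R (p' :: M ++ p :: L)) :
    3 * (p' :: M ++ p :: L).length ≤ 2 * totalLoss lab (p' :: M ++ p :: L) := by
  have key : ∀ (w : List (Kind × Bool)) (vs : List V) (d : ℕ), search w 0 d startBits = true →
      List.Forall₂ (fun c v => c.1.fits (kd v) = true) w vs → Marked lab w 0 vs →
      vs.Sublist (p' :: M ++ p :: L) → d < totalLoss lab vs := fun w vs d hs hf hm hsub =>
    search_sound hlab (W := p' :: M ++ p :: L)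
      (fun q hq ws hws => hR.not_forall₂ hbase hq (hR.sublist hws h)) w vs [] 0 d _ hs hf hm
      tracks_start hsub
  have hfy : ∀ {v}, kd v = .yy → Kind.fits .yy (kd v) = true := fun h => by rw [h]; rfl
  have hfs : ∀ {v}, kd v = .ss → Kind.fits .ss (kd v) = true := fun h => by rw [h]; rfl
  replace hp := hfs hp
  replace hp' := hfs hp'
  rcases hM.cases with ⟨y₁, rfl, hy₁⟩ | ⟨y₁, x₁, M, rfl, hy₁, hx₁, hM⟩ <;> replace hy₁ := hfy hy₁ <;>
  rcases hL.cases with ⟨z₁, rfl, hz₁⟩ | ⟨z₁, w₁, L, rfl, hz₁, hw₁, hL⟩ <;> replace hz₁ := hfy hz₁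
  · have := key _ [p', y₁, p, z₁] _ search_one_one
      (by simp [*]) (by simp [Marked]) (by simp)
    simp at this ⊢
    omega
  · simp at hle
  · rcases hM.cases with ⟨y₂, rfl, hy₂⟩ | ⟨y₂, x₂, M, rfl, hy₂, hx₂, hM⟩ <;> replace hy₂ := hfy hy₂
    · simp only [Heavy, List.isChain_cons_cons] at hhM
      have := key _ [p', y₁, x₁, y₂, p, z₁] _ search_three_one
        (by simp [*]) (by simp [Marked, hhM]) (by simp)
      simp at this ⊢
      omega
    rcases hM.cases with ⟨y₃, rfl, hy₃⟩ | ⟨y₃, x₃, M, rfl, hy₃, hx₃, hM⟩ <;> replace hy₃ := hfy hy₃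
    · simp only [Heavy, List.isChain_cons_cons] at hhM
      have := key _ [p', y₁, x₁, y₂, x₂, y₃, p, z₁] _ search_five_one
        (by simp [*]) (by simp [Marked, hhM]) (by simp)
      simp at this ⊢
      omega
    obtain ⟨y₄, M', rfl, hy₄⟩ : ∃ y₄ M', M = y₄ :: M' ∧ kd y₄ = .yy := by
      rcases hM.cases with ⟨y₃, rfl, hy₃⟩ | ⟨y₃, x₃, M, rfl, hy₃, hx₃, hM⟩
      exacts [⟨_, _, rfl, hy₃⟩, ⟨_, _, rfl, hy₃⟩]
    replace hy₄ := hfy hy₄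
    simp only [Heavy, List.isChain_cons_cons] at hhM
    have := key _ [p', y₁, x₁, y₂, x₂, y₃, x₃, y₄, p] _ search_seven
        (by simp [*]) (by simp [Marked, hhM]) (by simp)
    have := totalLoss_le (lab := lab) [p', y₁, x₁, y₂, x₂, y₃, x₃, y₄, p]
    simp at this
    omega
  · obtain ⟨z₂, L', rfl, hz₂⟩ : ∃ z₂ L', L = z₂ :: L' ∧ kd z₂ = .yy := by
      rcases hL.cases with ⟨y₃, rfl, hy₃⟩ | ⟨y₃, x₃, M, rfl, hy₃, hx₃, hM⟩
      exacts [⟨_, _, rfl, hy₃⟩, ⟨_, _, rfl, hy₃⟩]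
    replace hz₂ := hfy hz₂
    rcases hM.cases with ⟨y₂, rfl, hy₂⟩ | ⟨y₂, x₂, M, rfl, hy₂, hx₂, hM⟩ <;> replace hy₂ := hfy hy₂
    · simp only [Heavy, List.isChain_cons_cons] at hhM hhL
      have hL' : L' = [] := by
        simp only [List.length_cons, List.length_nil] at hle
        exact List.length_eq_zero_iff.1 (by omega)
      subst hL'
      have := key _ [p', y₁, x₁, y₂, p, z₁, w₁, z₂] _ search_three_three
        (by simp [*]) (by simp [Marked, hhM, hhL]) (by simp)
      simp at this ⊢
      omega
    obtain ⟨y₃, M', rfl, hy₃⟩ : ∃ z₂ L', M = z₂ :: L' ∧ kd z₂ = .yy := by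
      rcases hM.cases with ⟨y₃, rfl, hy₃⟩ | ⟨y₃, x₃, M, rfl, hy₃, hx₃, hM⟩
      exacts [⟨_, _, rfl, hy₃⟩, ⟨_, _, rfl, hy₃⟩]
    replace hy₃ := hfy hy₃
    simp only [Heavy, List.isChain_cons_cons] at hhM hhL
    have := key _ [p', y₁, x₁, y₂, x₂, y₃, p, z₁, w₁] _ search_five_two
        (by simp [*]) (by simp [Marked, hhM, hhL]) (by simp)
    have := totalLoss_le (lab := lab) [p', y₁, x₁, y₂, x₂, y₃, p, z₁, w₁]
    simp at this
    omega

/-- If no base pattern occurs on the second cycle, then on average at least half of the labels are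
missing. -/
theorem three_mul_length_le (hlab : ∀ v, lab v < 8) {R : List V → Prop} (hR : Cyclic R)
    (hbase : ∀ t ∈ labelPerms, ∀ p ∈ basePatterns t, ∀ ws, R ws → ¬ List.Forall₂ (Fits kd lab) p ws)
    {p p' : V} {M L : List V} (hp' : kd p' = .ss) (hp : kd p = .ss) (hM : Alternating kd M)
    (hL : Alternating kd L) (h : R (p' :: M ++ p :: L)) :
    3 * (p' :: M ++ p :: L).length ≤ 2 * totalLoss lab (p' :: M ++ p :: L) := by
  induction hn : M.length + L.length using Nat.strong_induction_on generalizing M L with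
  | _ n ih =>
  rcases hM.heavy_or (lab := lab) with hhM | ⟨M', hM', hsub, hlen, hloss⟩
  swap
  · have := ih (M'.length + L.length) (by omega) hM' hL
      (hR.sublist ((hsub.append (List.Sublist.refl (p :: L))).cons_cons _) h) rfl
    simp only [List.cons_append, List.length_cons, List.length_append, totalLoss_cons,
      totalLoss_append] at this ⊢
    omega
  rcases hL.heavy_or (lab := lab) with hhL | ⟨L', hL', hsub, hlen, hloss⟩
  swap
  · have := ih (M.length + L'.length) (by omega) hM hL'
      (hR.sublist (((List.Sublist.refl M).append (hsub.cons_cons _)).cons_cons _) h) rfl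
    simp only [List.cons_append, List.length_cons, List.length_append, totalLoss_cons,
      totalLoss_append] at this ⊢
    omega
  rcases le_total L.length M.length with hle | hle
  · exact three_mul_length_le_of_heavy hlab hR hbase hp' hp hM hL hhM hhL hle h
  · have := three_mul_length_le_of_heavy hlab hR hbase hp hp' hL hM hhL hhM hle (hR.rotate h)
    simp only [List.cons_append, List.length_cons, List.length_append, totalLoss_cons,
      totalLoss_append] at this ⊢
    omega

end Induction

section CyclicWords

variable {V : Type*}

/-- The cyclic word `D` describes a cycle of `G`. -/
structure IsCycleWord (G : SimpleGraph V) (D : List V) : Prop where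
  nodup : D.Nodup
  length : 3 ≤ D.length
  isChain : D.IsChain G.Adj
  adj : ∀ x ∈ D.getLast?, ∀ y ∈ D.head?, G.Adj x y

variable {G : SimpleGraph V}

theorem IsCycleWord.rotate {A B : List V} (h : IsCycleWord G (A ++ B)) :
    IsCycleWord G (B ++ A) := by
  rcases A.eq_nil_or_concat with rfl | ⟨A, a, rfl⟩
  · simpa using h
  cases B with
  | nil => simpa using h
  | cons b B =>
    obtain ⟨hA, hB, hAB⟩ := List.isChain_append.1 h.isChain
    refine ⟨(List.perm_append_comm.nodup_iff).1 h.nodup, ?_, ?_, ?_⟩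
    · have := h.length
      simp only [List.length_append] at this ⊢
      omega
    · refine List.isChain_append.2 ⟨hB, hA, fun x hx y hy => h.adj x ?_ y ?_⟩
      · rw [List.getLast?_append]; simp_all
      · rw [List.head?_append]; simp_all
    · intro x hx y hy
      refine hAB x ?_ y ?_
      · rw [List.getLast?_append] at hx; simp_all
      · rw [List.head?_append] at hy; simp_all

theorem IsCycleWord.reverse {A : List V} (h : IsCycleWord G A) : IsCycleWord G A.reverse where
  nodup := List.nodup_reverse.2 h.nodup
  length := by simpa using h.length
  isChain := List.isChain_reverse.2 (h.isChain.imp fun _ _ h => h.symm)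
  adj x hx y hy := (h.adj y (by simpa using hy) x (by simpa using hx)).symm

/-- The word `l` can be read along the cycle of `G` with vertices `D`, in one of its orientations,
in at most one turn. -/
def Readable (G : SimpleGraph V) (D l : List V) : Prop :=
  ∃ D', IsCycleWord G D' ∧ D'.Perm D ∧ l.Sublist D'

theorem cyclic_readable (G : SimpleGraph V) (D : List V) : Cyclic (Readable G D) where
  sublist := fun h ⟨D', h₁, h₂, h₃⟩ => ⟨D', h₁, h₂, h.trans h₃⟩
  rotate := by
    rintro l l' ⟨D', h₁, h₂, h₃⟩
    obtain ⟨A, B, rfl, hA, hB⟩ := List.append_sublist_iff.1 h₃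
    exact ⟨B ++ A, h₁.rotate, List.perm_append_comm.trans h₂, hB.append hA⟩
  reverse := fun ⟨D', h₁, h₂, h₃⟩ =>
    ⟨D'.reverse, h₁.reverse, (List.reverse_perm _).trans h₂, h₃.reverse⟩

theorem exists_suffix_of_sublist {l D : List V} (hl : l ≠ []) (h : l.Sublist D) :
    ∃ s, s <:+ D ∧ l.Sublist s ∧ s.head? = l.head? := by
  cases l with
  | nil => simp at hl
  | cons a t =>
    obtain ⟨r₁, r₂, rfl, ha, ht⟩ := List.cons_sublist_iff.1 h
    obtain ⟨p, q, rfl⟩ := List.append_of_mem ha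
    refine ⟨a :: q ++ r₂, ⟨p, by simp⟩, ?_, rfl⟩
    exact (ht.trans (List.sublist_append_right _ _)).cons_cons _

theorem exists_infix_of_sublist {l D : List V} (hl : l ≠ []) (h : l.Sublist D) :
    ∃ s, s <:+: D ∧ l.Sublist s ∧ s.head? = l.head? ∧ s.getLast? = l.getLast? := by
  obtain ⟨s, hs, hls, hh⟩ := exists_suffix_of_sublist hl h
  obtain ⟨r, hr, hlr, hh'⟩ := exists_suffix_of_sublist (by simpa using hl) hls.reverse
  refine ⟨r.reverse, ?_, by simpa using hlr.reverse, ?_, by simpa using hh'⟩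
  · exact (List.reverse_suffix.1 (by simpa using hr) : r.reverse <+: s).isInfix.trans hs.isInfix
  · obtain ⟨a, t, rfl⟩ := List.exists_cons_of_ne_nil hl
    have hpre : r.reverse <+: s := List.reverse_suffix.1 (by simpa using hr)
    have hne : r.reverse ≠ [] := by
      intro h0
      rw [List.reverse_eq_nil_iff.1 h0] at hlr
      simp at hlr
    obtain ⟨q, rfl⟩ := hpre
    rw [← hh, List.head?_append]
    obtain ⟨b, r', hb⟩ := List.exists_cons_of_ne_nil hne
    simp [hb]

/-- A word that splits into two nonempty parts yields two disjoint segments of the cycle. -/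
theorem Readable.exists_segments {D l₁ l₂ d : List V} (h : Readable G D (l₁ ++ l₂ ++ d))
    (h₁ : l₁ ≠ []) (h₂ : l₂ ≠ []) :
    ∃ s₁ s₂ : List V, (s₁ ++ s₂).Nodup ∧ (∀ x ∈ s₁ ++ s₂, x ∈ D) ∧
      s₁.length + s₂.length + d.length ≤ D.length ∧
      (s₁.IsChain G.Adj ∧ l₁.Sublist s₁ ∧ s₁.head? = l₁.head? ∧ s₁.getLast? = l₁.getLast?) ∧
      (s₂.IsChain G.Adj ∧ l₂.Sublist s₂ ∧ s₂.head? = l₂.head? ∧ s₂.getLast? = l₂.getLast?) := by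
  obtain ⟨D', hD', hp, h⟩ := h
  obtain ⟨D₁₂, D₃, rfl, h₁₂, hd⟩ := List.append_sublist_iff.1 h
  obtain ⟨D₁, D₂, rfl, hl₁, hl₂⟩ := List.append_sublist_iff.1 h₁₂
  obtain ⟨s₁, hs₁, h₁⟩ := exists_infix_of_sublist h₁ hl₁
  obtain ⟨s₂, hs₂, h₂⟩ := exists_infix_of_sublist h₂ hl₂
  have hsub : (s₁ ++ s₂).Sublist (D₁ ++ D₂ ++ D₃) :=
    (hs₁.sublist.append hs₂.sublist).trans (List.sublist_append_left _ _)
  refine ⟨s₁, s₂, hsub.nodup hD'.nodup, fun x hx => hp.mem_iff.1 (hsub.subset hx), ?_,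
    ⟨?_, h₁⟩, ⟨?_, h₂⟩⟩
  · rw [← hp.length_eq]
    have := hs₁.length_le
    have := hs₂.length_le
    have := hd.length_le
    simp only [List.length_append]
    omega
  · exact hD'.isChain.infix (hs₁.trans (by simpa using (List.infix_append [] D₁ (D₂ ++ D₃))))
  · exact hD'.isChain.infix (hs₂.trans (List.infix_append D₁ D₂ D₃))

theorem isCycleWord_append {s t : List V} (hnd : (s ++ t).Nodup) (hlen : 3 ≤ s.length + t.length)
    (hs : s.IsChain G.Adj) (ht : t.IsChain G.Adj) (hs₀ : s ≠ []) (ht₀ : t ≠ [])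
    (hst : ∀ x ∈ s.getLast?, ∀ y ∈ t.head?, G.Adj x y)
    (hts : ∀ x ∈ t.getLast?, ∀ y ∈ s.head?, G.Adj x y) : IsCycleWord G (s ++ t) where
  nodup := hnd
  length := by simpa using hlen
  isChain := List.isChain_append.2 ⟨hs, ht, hst⟩
  adj x hx y hy := by
    obtain ⟨a, s, rfl⟩ := List.exists_cons_of_ne_nil hs₀
    obtain ⟨b, t, rfl⟩ := List.exists_cons_of_ne_nil ht₀
    refine hts x ?_ y (by simpa using hy)
    rw [List.getLast?_append] at hx
    simp_all

variable {S : Finset V} [DecidableEq V]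

/-- `C` and `D` are the vertex sets of two disjoint cycles, and there are no two disjoint
feasible cycles of smaller total order. -/
structure Minimal (G : SimpleGraph V) (S : Finset V) (C D : List V) : Prop where
  disjoint : C.Disjoint D
  le : ∀ A B, IsCycleWord G A → IsCycleWord G B → A.Disjoint B → 2 ≤ A.countP (· ∈ S) →
    2 ≤ B.countP (· ∈ S) → C.length + D.length ≤ A.length + B.length

/-- The ends of the paths `l` and `m` are joined by edges so that a feasible cycle arises. -/
structure Joined (G : SimpleGraph V) (S : Finset V) (l m : List V) : Prop where
  left_ne_nil : l ≠ []
  right_ne_nil : m ≠ []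
  length : 3 ≤ l.length + m.length
  count : 2 ≤ (l ++ m).countP (· ∈ S)
  adj : ∀ x ∈ l.getLast?, ∀ y ∈ m.head?, G.Adj x y
  adj' : ∀ x ∈ m.getLast?, ∀ y ∈ l.head?, G.Adj x y

/-- In a minimal system one cannot recombine segments of the two cycles to two feasible cycles
without using all vertices. -/
theorem Minimal.false_of_joined {C D : List V} (h : Minimal G S C D) {l₁ l₂ d m₁ m₂ c : List V}
    (hl : Readable G C (l₁ ++ l₂ ++ d)) (hm : Readable G D (m₁ ++ m₂ ++ c)) (hdc : d ++ c ≠ [])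
    (h₁ : Joined G S l₁ m₁) (h₂ : Joined G S l₂ m₂) : False := by
  obtain ⟨s₁, s₂, hsn, hsC, hslen, hs₁, hs₂⟩ :=
    hl.exists_segments h₁.left_ne_nil h₂.left_ne_nil
  obtain ⟨t₁, t₂, htn, htD, htlen, ht₁, ht₂⟩ :=
    hm.exists_segments h₁.right_ne_nil h₂.right_ne_nil
  have key : ∀ {l m s t : List V}, Joined G S l m →
      (s.IsChain G.Adj ∧ l.Sublist s ∧ s.head? = l.head? ∧ s.getLast? = l.getLast?) →
      (t.IsChain G.Adj ∧ m.Sublist t ∧ t.head? = m.head? ∧ t.getLast? = m.getLast?) →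
      (s ++ t).Nodup → IsCycleWord G (s ++ t) ∧ 2 ≤ (s ++ t).countP (· ∈ S) := by
    rintro l m s t hj ⟨hs, hls, hs₁, hs₂⟩ ⟨ht, hmt, ht₁, ht₂⟩ hnd
    refine ⟨isCycleWord_append hnd ?_ hs ht ?_ ?_ ?_ ?_,
      hj.count.trans ((hls.append hmt).countP_le)⟩
    · have := hj.length
      have := hls.length_le
      have := hmt.length_le
      omega
    · rintro rfl
      exact hj.left_ne_nil (List.sublist_nil.1 hls)
    · rintro rfl
      exact hj.right_ne_nil (List.sublist_nil.1 hmt)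
    · rw [hs₂, ht₁]
      exact hj.adj
    · rw [hs₁, ht₂]
      exact hj.adj'
  have hCD : ∀ x ∈ s₁ ++ s₂, ∀ y ∈ t₁ ++ t₂, x ≠ y := by
    rintro x hx _ hy rfl
    exact h.disjoint (hsC x hx) (htD x hy)
  simp only [List.nodup_append', List.mem_append] at hsn htn hCD
  have hnd : ∀ {s t : List V}, s.Nodup → t.Nodup → (∀ x ∈ s, ∀ y ∈ t, x ≠ y) → (s ++ t).Nodup :=
    fun hs ht h => List.nodup_append.2 ⟨hs, ht, h⟩
  obtain ⟨hA, hA'⟩ := key h₁ hs₁ ht₁ (hnd hsn.1 htn.1 fun x hx y hy => hCD x (.inl hx) y (.inl hy))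
  obtain ⟨hB, hB'⟩ := key h₂ hs₂ ht₂
    (hnd hsn.2.1 htn.2.1 fun x hx y hy => hCD x (.inr hx) y (.inr hy))
  have hle := h.le _ _ hA hB (by
    intro x hx hx'
    rcases List.mem_append.1 hx with hx | hx <;> rcases List.mem_append.1 hx' with hx' | hx'
    · exact hsn.2.2 hx hx'
    · exact hCD x (.inl hx) x (.inr hx') rfl
    · exact hCD x (.inr hx') x (.inl hx) rfl
    · exact htn.2.2 hx hx') hA' hB'
  have := List.length_pos_iff.2 hdc
  simp only [List.length_append] at this hle
  omega

end CyclicWords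

section Hexagons

variable {V : Type*} {G : SimpleGraph V} {X S : Finset V}

/-- The kind of a vertex. -/
def kind [DecidableEq V] (X S : Finset V) (v : V) : Kind :=
  if v ∈ S then .ss else if v ∈ X then .xx else .yy

/-- Three vertices of `S` on the cycle `C`, and three vertices outside `X`, which may serve as
their successors and predecessors. The vertex `z t` is opposite to `u t`. -/
structure Hexagon (G : SimpleGraph V) (X S : Finset V) (C : List V) (u z : ℕ → V) : Prop where
  mem : ∀ t ∈ [1, 2, 4], u t ∈ S
  notMem : ∀ t ∈ [1, 2, 4], z t ∉ X
  readable : ∀ i j k, (i, j, k) ∈ labelPerms → Readable G C [u i, z k, u j, z i, u k, z j]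

/-- The vertex `v` carries the label `t`. -/
def HasLabel (G : SimpleGraph V) (u z : ℕ → V) (t : ℕ) (v : V) : Prop :=
  G.Adj (u t) v ∨ G.Adj (z t) v

open Classical in
/-- The bit mask of the labels of a vertex. -/
noncomputable def labels (G : SimpleGraph V) (u z : ℕ → V) (v : V) : ℕ :=
  (if HasLabel G u z 1 v then 1 else 0) + (if HasLabel G u z 2 v then 2 else 0) +
    (if HasLabel G u z 4 v then 4 else 0)

theorem hasLabel_of_land {u z : ℕ → V} {v : V} {i j k : ℕ} (hi : (i, j, k) ∈ labelPerms) :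
    (Nat.land i (labels G u z v) = i → HasLabel G u z i v) ∧
    (Nat.land (i + j) (labels G u z v) = i + j → HasLabel G u z i v ∧ HasLabel G u z j v) := by
  simp only [labelPerms, List.mem_cons, Prod.mk.injEq, List.not_mem_nil, or_false] at hi
  unfold labels
  rcases hi with ⟨rfl, rfl, rfl⟩ | ⟨rfl, rfl, rfl⟩ | ⟨rfl, rfl, rfl⟩ | ⟨rfl, rfl, rfl⟩ |
    ⟨rfl, rfl, rfl⟩ | ⟨rfl, rfl, rfl⟩ <;>
  by_cases h₁ : HasLabel G u z 1 v <;> by_cases h₂ : HasLabel G u z 2 v <;>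
    by_cases h₄ : HasLabel G u z 4 v <;> simp [h₁, h₂, h₄]

theorem labelPerms_symm {i j k : ℕ} (h : (i, j, k) ∈ labelPerms) :
    (i, k, j) ∈ labelPerms ∧ (j, i, k) ∈ labelPerms ∧ (j, k, i) ∈ labelPerms ∧
      (k, i, j) ∈ labelPerms ∧ (k, j, i) ∈ labelPerms ∧ i ∈ [1, 2, 4] := by
  simp only [labelPerms, List.mem_cons, Prod.mk.injEq, List.not_mem_nil, or_false] at h
  rcases h with ⟨rfl, rfl, rfl⟩ | ⟨rfl, rfl, rfl⟩ | ⟨rfl, rfl, rfl⟩ | ⟨rfl, rfl, rfl⟩ |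
    ⟨rfl, rfl, rfl⟩ | ⟨rfl, rfl, rfl⟩ <;> decide

theorem Hexagon.readable_succ {C : List V} {u z : ℕ → V} (h : Hexagon G X S C u z) {i j k : ℕ}
    (hi : (i, j, k) ∈ labelPerms) : Readable G C [z k, u j, z i, u k, z j, u i] :=
  (cyclic_readable G C).rotate (l := [u i]) (h.readable i j k hi)

/-- A vertex of `X` with a label is adjacent to the corresponding vertex outside `X`. -/
theorem Hexagon.adj_of_mem {C : List V} {u z : ℕ → V} (h : Hexagon G X S C u z)
    (hG : ∀ a b, G.Adj a b → (a ∈ X ↔ b ∉ X)) (hSX : S ⊆ X) {t : ℕ} (ht : t ∈ [1, 2, 4]) {v : V}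
    (hv : v ∈ X) (hl : HasLabel G u z t v) : G.Adj (z t) v :=
  hl.resolve_left fun hl => (hG _ _ hl).1 (hSX (h.mem t ht)) hv

theorem Hexagon.adj_of_notMem {C : List V} {u z : ℕ → V} (h : Hexagon G X S C u z)
    (hG : ∀ a b, G.Adj a b → (a ∈ X ↔ b ∉ X)) {t : ℕ} (ht : t ∈ [1, 2, 4]) {v : V}
    (hv : v ∉ X) (hl : HasLabel G u z t v) : G.Adj (u t) v :=
  hl.resolve_right fun hl => h.notMem t ht ((hG _ _ hl).2 hv)

variable [DecidableEq V]

theorem kind_of_fits_ss {v : V} (h : Kind.ss.fits (kind X S v) = true) : v ∈ S := by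
  unfold kind at h
  split_ifs at h with h₁ h₂ <;> simp_all [Kind.fits]

theorem kind_of_fits_xx {v : V} (hSX : S ⊆ X) (h : Kind.xx.fits (kind X S v) = true) : v ∈ X := by
  unfold kind at h
  split_ifs at h with h₁ h₂ <;> simp_all [Kind.fits]
  exact hSX h₁

theorem kind_of_fits_yy {v : V} (h : Kind.yy.fits (kind X S v) = true) : v ∉ X := by
  unfold kind at h
  split_ifs at h with h₁ h₂ <;> simp_all [Kind.fits]

/-- No base pattern occurs on the second cycle of a minimal system. -/
theorem Hexagon.not_forall₂ {C D : List V} {u z : ℕ → V} (h : Hexagon G X S C u z)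
    (hG : ∀ a b, G.Adj a b → (a ∈ X ↔ b ∉ X)) (hSX : S ⊆ X) (hmin : Minimal G S C D) :
    ∀ t ∈ labelPerms, ∀ p ∈ basePatterns t, ∀ ws, Readable G D ws →
      ¬ List.Forall₂ (Fits (kind X S) (labels G u z)) p ws := by
  rintro ⟨i, j, k⟩ hi p hp ws hws hf
  obtain ⟨hikj, hjik, hjki, hkij, hkji, hi₁⟩ := labelPerms_symm hi
  have hmi := h.mem i hi₁
  have hmj := h.mem j (labelPerms_symm hjik).2.2.2.2.2
  have hmk := h.mem k (labelPerms_symm hkij).2.2.2.2.2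
  have hX : ∀ {c m v}, c = Kind.xx ∨ c = Kind.ss →
      Fits (kind X S) (labels G u z) (c, m) v → v ∈ X := by
    rintro c m v (rfl | rfl) h
    exacts [kind_of_fits_xx hSX h.1, hSX (kind_of_fits_ss h.1)]
  have hx : ∀ {c : Kind} {a b d v}, (a, b, d) ∈ labelPerms → c = .xx ∨ c = .ss →
      Fits (kind X S) (labels G u z) (c, a) v → G.Adj (z a) v ∧ G.Adj v (z a) := by
    intro c a b d v ha hc hv
    have := h.adj_of_mem hG hSX (labelPerms_symm ha).2.2.2.2.2 (hX hc hv)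
      ((hasLabel_of_land ha).1 hv.2)
    exact ⟨this, this.symm⟩
  have hx₂ : ∀ {c : Kind} {a b d v}, (a, b, d) ∈ labelPerms → c = .xx ∨ c = .ss →
      Fits (kind X S) (labels G u z) (c, a + b) v →
      (G.Adj (z a) v ∧ G.Adj v (z a)) ∧ G.Adj (z b) v ∧ G.Adj v (z b) := by
    intro c a b d v ha hc hv
    obtain ⟨ha', hb'⟩ := (hasLabel_of_land ha).2 hv.2
    have h₁ := h.adj_of_mem hG hSX (labelPerms_symm ha).2.2.2.2.2 (hX hc hv) ha'
    have h₂ := h.adj_of_mem hG hSX (labelPerms_symm (labelPerms_symm ha).2.1).2.2.2.2.2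
      (hX hc hv) hb'
    exact ⟨⟨h₁, h₁.symm⟩, h₂, h₂.symm⟩
  have hy : ∀ {a b d v}, (a, b, d) ∈ labelPerms →
      Fits (kind X S) (labels G u z) (.yy, a) v → G.Adj (u a) v ∧ G.Adj v (u a) := by
    intro a b d v ha hv
    have := h.adj_of_notMem hG (labelPerms_symm ha).2.2.2.2.2 (kind_of_fits_yy hv.1)
      ((hasLabel_of_land ha).1 hv.2)
    exact ⟨this, this.symm⟩
  have hy₂ : ∀ {a b d v}, (a, b, d) ∈ labelPerms →
      Fits (kind X S) (labels G u z) (.yy, a + b) v →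
      (G.Adj (u a) v ∧ G.Adj v (u a)) ∧ G.Adj (u b) v ∧ G.Adj v (u b) := by
    intro a b d v ha hv
    obtain ⟨ha', hb'⟩ := (hasLabel_of_land ha).2 hv.2
    have h₁ := h.adj_of_notMem hG (labelPerms_symm ha).2.2.2.2.2 (kind_of_fits_yy hv.1) ha'
    have h₂ := h.adj_of_notMem hG (labelPerms_symm (labelPerms_symm ha).2.1).2.2.2.2.2
      (kind_of_fits_yy hv.1) hb'
    exact ⟨⟨h₁, h₁.symm⟩, h₂, h₂.symm⟩
  have hs : ∀ {a v}, Fits (kind X S) (labels G u z) (.ss, a) v → v ∈ S :=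
    fun h => kind_of_fits_ss h.1
  simp only [basePatterns, List.mem_cons, List.not_mem_nil, or_false] at hp
  rcases hp with rfl | rfl | rfl | rfl | rfl | rfl | rfl | rfl | rfl
  · rcases hf with _ | ⟨h₁, _ | ⟨h₂, _ | ⟨h₃, _ | _⟩⟩⟩
    rename_i v p c
    have e₁ := hy₂ hi h₁
    have e₂ := hx₂ hi (.inr rfl) h₂
    have e₃ := hs h₂
    refine hmin.false_of_joined (l₁ := [u i, z k, u j]) (l₂ := [z i, u k, z j]) (d := [])
      (m₁ := [v]) (m₂ := [p]) (c := [c]) (h.readable _ _ _ hi) hws (by simp)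
      ⟨by simp, by simp, by simp, ?_, ?_, ?_⟩ ⟨by simp, by simp, by simp, ?_, ?_, ?_⟩ <;>
    simp [List.countP_cons, *] <;> omega
  · rcases hf with _ | ⟨h₁, _ | ⟨h₂, _ | ⟨h₃, _ | ⟨h₄, _ | ⟨h₅, _ | _⟩⟩⟩⟩⟩
    rename_i x a p b c
    have e₁ := hx₂ hjki (.inl rfl) h₁
    have e₂ := hy hi h₂
    have e₃ := hs h₃
    have e₄ := hy hi h₄
    refine hmin.false_of_joined (l₁ := [z k, u j, z i, u k, z j]) (l₂ := [u i]) (d := [])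
      (m₁ := [x]) (m₂ := [a, p, b]) (c := [c]) (h.readable_succ hi) hws (by simp)
      ⟨by simp, by simp, by simp, ?_, ?_, ?_⟩ ⟨by simp, by simp, by simp, ?_, ?_, ?_⟩ <;>
    simp [List.countP_cons, *] <;> omega
  · rcases hf with _ | ⟨h₁, _ | ⟨h₂, _ | ⟨h₃, _ | ⟨h₄, _ | ⟨h₅, _ | _⟩⟩⟩⟩⟩
    rename_i x v a p b
    have e₁ := hx hi (.inl rfl) h₁
    have e₂ := hy hi h₂
    have e₃ := hy hjik h₃
    have e₄ := hs h₄
    have e₅ := hy hjik h₅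
    refine hmin.false_of_joined (l₁ := [u i, z j, u k, z i]) (l₂ := [u j]) (d := [z k])
      (m₁ := [x, v]) (m₂ := [a, p, b]) (c := []) (h.readable _ _ _ hikj) hws (by simp)
      ⟨by simp, by simp, by simp, ?_, ?_, ?_⟩ ⟨by simp, by simp, by simp, ?_, ?_, ?_⟩ <;>
    simp [List.countP_cons, *] <;> omega
  · rcases hf with _ | ⟨h₁, _ | ⟨h₂, _ | ⟨h₃, _ | ⟨h₄, _ | ⟨h₅, _ | ⟨h₆, _ | _⟩⟩⟩⟩⟩⟩
    rename_i x v w p a c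
    have e₁ := hx hi (.inl rfl) h₁
    have e₂ := hy hi h₂
    have e₃ := hx hkij (.inl rfl) h₃
    have e₄ := hs h₄
    have e₅ := hy hjik h₅
    refine hmin.false_of_joined (l₁ := [u i, z j, u k, z i]) (l₂ := [u j, z k]) (d := [])
      (m₁ := [x, v]) (m₂ := [w, p, a]) (c := [c]) (h.readable _ _ _ hikj) hws (by simp)
      ⟨by simp, by simp, by simp, ?_, ?_, ?_⟩ ⟨by simp, by simp, by simp, ?_, ?_, ?_⟩ <;>
    simp [List.countP_cons, *] <;> omega
  · rcases hf with _ | ⟨h₁, _ | ⟨h₂, _ | ⟨h₃, _ | _⟩⟩⟩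
    rename_i v p q
    have e₁ := hy₂ hi h₁
    have e₂ := hx hi (.inr rfl) h₂
    have e₃ := hx hi (.inr rfl) h₃
    have e₄ := hs h₂
    have e₅ := hs h₃
    refine hmin.false_of_joined (l₁ := [u i, z k, u j]) (l₂ := [z i]) (d := [u k, z j])
      (m₁ := [v]) (m₂ := [p, q]) (c := []) (h.readable _ _ _ hi) hws (by simp)
      ⟨by simp, by simp, by simp, ?_, ?_, ?_⟩ ⟨by simp, by simp, by simp, ?_, ?_, ?_⟩ <;>
    simp [List.countP_cons, *]; omega
  · rcases hf with _ | ⟨h₁, _ | ⟨h₂, _ | ⟨h₃, _ | ⟨h₄, _ | _⟩⟩⟩⟩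
    rename_i v x p q
    have e₁ := hy hkij h₁
    have e₂ := hx hkij (.inl rfl) h₂
    have e₃ := hx hi (.inr rfl) h₃
    have e₄ := hx hi (.inr rfl) h₄
    have e₅ := hs h₃
    have e₆ := hs h₄
    refine hmin.false_of_joined (l₁ := [z k, u i, z j, u k]) (l₂ := [z i]) (d := [u j])
      (m₁ := [v, x]) (m₂ := [p, q]) (c := []) (h.readable_succ hjik) hws (by simp)
      ⟨by simp, by simp, by simp, ?_, ?_, ?_⟩ ⟨by simp, by simp, by simp, ?_, ?_, ?_⟩ <;>
    simp [List.countP_cons, *]; omega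
  · rcases hf with _ | ⟨h₁, _ | ⟨h₂, _ | ⟨h₃, _ | ⟨h₄, _ | _⟩⟩⟩⟩
    rename_i q a p b
    have e₁ := hx₂ hi (.inr rfl) h₁
    have e₂ := hs h₁
    have e₃ := hy hi h₂
    have e₄ := hs h₃
    have e₅ := hy hi h₄
    refine hmin.false_of_joined (l₁ := [z i, u k, z j]) (l₂ := [u i]) (d := [z k, u j])
      (m₁ := [q]) (m₂ := [a, p, b]) (c := []) (h.readable_succ hjki) hws (by simp)
      ⟨by simp, by simp, by simp, ?_, ?_, ?_⟩ ⟨by simp, by simp, by simp, ?_, ?_, ?_⟩ <;>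
    simp [List.countP_cons, *] <;> omega
  · rcases hf with _ | ⟨h₁, _ | ⟨h₂, _ | ⟨h₃, _ | _⟩⟩⟩
    rename_i y p q
    have e₁ := hy hi h₁
    have e₂ := hx hjik (.inr rfl) h₂
    have e₃ := hs h₂
    have e₄ := hx₂ hikj (.inr rfl) h₃
    have e₅ := hs h₃
    refine hmin.false_of_joined (l₁ := [z j, u i]) (l₂ := [z k, u j, z i]) (d := [u k])
      (m₁ := [y, p]) (m₂ := [q]) (c := []) (h.readable_succ hkij) hws (by simp)
      ⟨by simp, by simp, by simp, ?_, ?_, ?_⟩ ⟨by simp, by simp, by simp, ?_, ?_, ?_⟩ <;>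
    simp [List.countP_cons, *] <;> omega
  · rcases hf with _ | ⟨h₁, _ | ⟨h₂, _ | ⟨h₃, _ | _⟩⟩⟩
    rename_i p y v
    have e₁ := hx hjik (.inr rfl) h₁
    have e₂ := hs h₁
    have e₃ := hy hkij h₂
    have e₄ := hy₂ hi h₃
    refine hmin.false_of_joined (l₁ := [u k, z j]) (l₂ := [u i, z k, u j]) (d := [z i])
      (m₁ := [p, y]) (m₂ := [v]) (c := []) (h.readable _ _ _ hkij) hws (by simp)
      ⟨by simp, by simp, by simp, ?_, ?_, ?_⟩ ⟨by simp, by simp, by simp, ?_, ?_, ?_⟩ <;>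
    simp [List.countP_cons, *] <;> omega

end Hexagons

section Walks

variable {V : Type*} {G : SimpleGraph V}

theorem isCycleWord_support_tail {v : V} {c : G.Walk v v} (hc : c.IsCycle) :
    IsCycleWord G c.support.tail where
  nodup := hc.support_nodup
  length := by simpa using hc.three_le_length
  isChain := c.isChain_adj_support.tail
  adj := by
    have h := c.isChain_adj_support
    have hl : c.support.getLast? = some v := by
      rw [List.getLast?_eq_some_getLast c.support_ne_nil, c.getLast_support]
    rw [← c.cons_tail_support] at h hl
    intro x hx y hy
    obtain ⟨z, l, hz⟩ : ∃ z l, c.support.tail = z :: l :=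
      List.exists_cons_of_ne_nil (by rintro h; simp [h] at hx)
    rw [hz] at h hl hx hy
    rw [List.getLast?_cons_cons, hx] at hl
    obtain rfl : x = v := by simpa using hl
    obtain rfl : z = y := by simpa using hy
    exact (List.isChain_cons_cons.1 h).1

theorem mem_support_tail_iff {v w : V} {c : G.Walk v v} (hc : c.IsCycle) :
    w ∈ c.support.tail ↔ w ∈ c.support := by
  refine ⟨List.mem_of_mem_tail, fun hw => ?_⟩
  rw [← c.cons_tail_support, List.mem_cons] at hw
  rcases hw with rfl | hw
  · have h₀ : c.support.tail ≠ [] := fun h => by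
      have := (isCycleWord_support_tail hc).length
      rw [h] at this
      simp at this
    have := List.getLast_mem h₀
    rwa [List.getLast_tail, c.getLast_support] at this
  · exact hw

theorem infix_support_of_mem_darts {u v : V} {p : G.Walk u v} {d : G.Dart} (hd : d ∈ p.darts) :
    [d.fst, d.snd] <:+: p.support := by
  induction p with
  | nil => simp at hd
  | cons h p ih =>
    rw [SimpleGraph.Walk.darts_cons, List.mem_cons] at hd
    rw [SimpleGraph.Walk.support_cons]
    rcases hd with rfl | hd
    · rw [← p.cons_tail_support]
      exact ⟨[], p.support.tail, rfl⟩
    · exact (ih hd).trans (List.suffix_cons _ _).isInfix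

/-- A cycle read from one of its vertices. -/
theorem exists_cycleWord {v a : V} {c : G.Walk v v} (hc : c.IsCycle) (ha : a ∈ c.support) :
    ∃ R, IsCycleWord G (a :: R) ∧ (a :: R).Perm c.support.tail ∧
      ∀ d ∈ c.darts, d.snd ≠ a → [d.fst, d.snd] <:+: a :: R := by
  classical
  have hc' := isCycleWord_support_tail (hc.rotate ha)
  have hp := (c.support_rotate a ha).perm
  have hd := (c.rotate_darts a ha).perm
  generalize c.rotate a ha = c' at *
  have hl : c'.support.getLast? = some a := by
    rw [List.getLast?_eq_some_getLast c'.support_ne_nil, c'.getLast_support]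
  have hs := c'.cons_tail_support
  have h₀ : c'.support.tail ≠ [] := fun h => by
    have := hc'.length
    rw [h] at this
    simp at this
  obtain ⟨R, b, hR⟩ := (List.eq_nil_or_concat _).resolve_left h₀
  rw [List.concat_eq_append] at hR
  rw [← hs, hR, ← List.cons_append, List.getLast?_concat] at hl
  obtain rfl : b = a := by simpa using hl
  rw [hR] at hc' hp hs
  refine ⟨R, by simpa using hc'.rotate, (List.perm_append_comm (l₁ := [b])).trans hp,
    fun d hdc hne => ?_⟩
  have := infix_support_of_mem_darts (hd.mem_iff.2 hdc)
  rw [← hs, ← List.cons_append, List.infix_concat_iff] at this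
  refine this.resolve_left fun h => hne ?_
  obtain ⟨t, ht⟩ := h
  have := congrArg List.getLast? ht
  rw [List.getLast?_concat, List.getLast?_append] at this
  simpa using this

theorem sublist_insert_succ {L l₁ l₂ : List V} {x y : V} (hL : L.Nodup)
    (h : (l₁ ++ x :: l₂).Sublist L) (hxy : [x, y] <:+: L) (hy : y ∉ l₂) :
    (l₁ ++ x :: y :: l₂).Sublist L := by
  obtain ⟨A, B, rfl, hA, hB⟩ := List.append_sublist_iff.1 h
  obtain ⟨B₁, B₂, rfl, hx, hB₂⟩ := List.cons_sublist_iff.1 hB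
  obtain ⟨P, Q, rfl⟩ := List.append_of_mem hx
  obtain ⟨M, N, hMN⟩ := hxy
  have heq : M ++ x :: (y :: N) = (A ++ P) ++ x :: (Q ++ B₂) := by simpa using hMN
  have hn : (M ++ x :: (y :: N)).Nodup := by rw [heq]; simpa using hL
  have hxM : x ∉ M := fun h => (List.nodup_append.1 hn).2.2 _ h _ (by simp) rfl
  have hxN : x ∉ y :: N := (List.nodup_cons.1 (List.nodup_append.1 hn).2.1).1
  obtain ⟨-, -, hN⟩ := (List.append_cons_inj_of_notMem hxM hxN).1 heq
  have : (y :: l₂).Sublist (Q ++ B₂) := by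
    rw [← hN]
    refine List.Sublist.cons_cons y ?_
    have h₂ : l₂.Sublist (y :: N) := hN ▸ (hB₂.trans (List.sublist_append_right _ _))
    cases h₂ with
    | cons _ h => exact h
    | cons_cons _ h => simp at hy
  have := (hA.trans (List.sublist_append_left A P)).append (this.cons_cons x)
  simpa using this

theorem pair_sublist {L : List V} {b c : V} (hb : b ∈ L) (hc : c ∈ L) (hbc : b ≠ c) :
    [b, c].Sublist L ∨ [c, b].Sublist L := by
  obtain ⟨A, B, rfl⟩ := List.append_of_mem hb
  rcases List.mem_append.1 hc with hc | hc
  · exact .inr ((List.singleton_sublist.2 hc).append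
      (List.singleton_sublist.2 (List.mem_cons_self)))
  · refine .inl (List.Sublist.trans ?_ (List.sublist_append_right A _))
    exact (List.singleton_sublist.2 ((List.mem_cons.1 hc).resolve_left hbc.symm)).cons_cons b

end Walks

section Triples

variable {V : Type*} {G : SimpleGraph V} {X S : Finset V}

/-- The choice of the first, second or third of three vertices for the labels `1`, `2`, `4`. -/
def choose₃ (a b c : V) (t : ℕ) : V := if t = 1 then a else if t = 2 then b else c

theorem Readable.hexagon {C : List V} {a b c x y z : V} (h : Readable G C [a, x, b, y, c, z])
    (ha : a ∈ S) (hb : b ∈ S) (hc : c ∈ S) (hx : x ∉ X) (hy : y ∉ X) (hz : z ∉ X) :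
    Hexagon G X S C (choose₃ a b c) (choose₃ y z x) where
  mem := by simp [choose₃, *]
  notMem := by simp [choose₃, *]
  readable i j k hi := by
    have hR := cyclic_readable G C
    have h₁ := hR.rotate (l := [a, x]) (l' := [b, y, c, z]) h
    have h₂ := hR.rotate (l := [b, y]) (l' := [c, z, a, x]) h₁
    have h₃ := hR.rotate (l := [z]) (l' := [c, y, b, x, a]) (hR.reverse h)
    have h₄ := hR.rotate (l := [c, y]) (l' := [b, x, a, z]) h₃
    have h₅ := hR.rotate (l := [b, x]) (l' := [a, z, c, y]) h₄
    simp only [labelPerms, List.mem_cons, Prod.mk.injEq, List.not_mem_nil, or_false] at hi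
    rcases hi with ⟨rfl, rfl, rfl⟩ | ⟨rfl, rfl, rfl⟩ | ⟨rfl, rfl, rfl⟩ | ⟨rfl, rfl, rfl⟩ |
      ⟨rfl, rfl, rfl⟩ | ⟨rfl, rfl, rfl⟩
    exacts [h, h₅, h₄, h₁, h₂, h₃]

/-- Three vertices of `S` on a cycle, together with their successors, form a hexagon. -/
theorem exists_hexagon {v : V} {p : G.Walk v v} (hp : p.IsCycle)
    (hG : ∀ a b, G.Adj a b → (a ∈ X ↔ b ∉ X)) (hSX : S ⊆ X) {σ : V → V}
    (hσ : ∀ u ∈ p.support, ∃ d ∈ p.darts, d.toProd = (u, σ u)) {a b c : V}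
    (ha : a ∈ S) (hb : b ∈ S) (hc : c ∈ S) (ha' : a ∈ p.support) (hb' : b ∈ p.support)
    (hc' : c ∈ p.support) (hab : a ≠ b) (hac : a ≠ c) (hbc : b ≠ c) :
    ∃ u z : ℕ → V, Hexagon G X S p.support.tail u z ∧ ∀ f : V → ℕ,
      f (u 1) + f (u 2) + f (u 4) + (f (z 1) + f (z 2) + f (z 4)) =
        (f a + f (σ a)) + (f b + f (σ b)) + (f c + f (σ c)) := by
  obtain ⟨R, hR, hperm, hinf⟩ := exists_cycleWord hp ha'
  have hσX : ∀ w ∈ S, w ∈ p.support → σ w ∉ X := by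
    intro w hw hw'
    obtain ⟨d, -, hd⟩ := hσ w hw'
    have := d.adj
    rw [hd] at this
    exact (hG _ _ this).1 (hSX hw)
  have hpair : ∀ w ∈ S, w ∈ p.support → [w, σ w] <:+: a :: R := by
    intro w hw hw'
    obtain ⟨d, hd, hdw⟩ := hσ w hw'
    have := hinf d hd (by rw [hdw]; rintro rfl; exact hσX w hw hw' (hSX ha))
    rwa [hdw] at this
  have hmem : ∀ w ∈ p.support, w ≠ a → w ∈ R := fun w hw hwa =>
    (List.mem_cons.1 (hperm.mem_iff.2 ((mem_support_tail_iff hp).2 hw))).resolve_left hwa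
  have key : ∀ b c, b ∈ S → c ∈ S → b ∈ p.support → c ∈ p.support → [b, c].Sublist R →
      Hexagon G X S p.support.tail (choose₃ a b c) (choose₃ (σ b) (σ c) (σ a)) := by
    intro b c hb hc hb' hc' hsub
    have hne : ∀ w ∈ S, w ∈ p.support → ∀ w' ∈ S, σ w ≠ w' :=
      fun w hw hw' w' h h' => hσX w hw hw' (h' ▸ hSX h)
    have h₁ := sublist_insert_succ (l₁ := []) hR.nodup (hsub.cons_cons a) (hpair a ha ha')
      (by simp [hne a ha ha' b hb, hne a ha ha' c hc])
    have h₂ := sublist_insert_succ (l₁ := [a, σ a]) hR.nodup h₁ (hpair b hb hb')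
      (by simp [hne b hb hb' c hc])
    have h₃ := sublist_insert_succ (l₁ := [a, σ a, b, σ b]) hR.nodup h₂ (hpair c hc hc') (by simp)
    exact Readable.hexagon ⟨_, hR, hperm, h₃⟩ ha hb hc (hσX a ha ha') (hσX b hb hb')
      (hσX c hc hc')
  rcases pair_sublist (hmem b hb' hab.symm) (hmem c hc' hac.symm) hbc with h | h
  · exact ⟨_, _, key b c hb hc hb' hc' h, fun f => by simp [choose₃]; ring⟩
  · exact ⟨_, _, key c b hc hb hc' hb' h, fun f => by simp [choose₃]; ring⟩

end Triples

section Counting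

variable {V : Type*} {G : SimpleGraph V} {X S : Finset V}

theorem labels_lt (u z : ℕ → V) (v : V) : labels G u z v < 8 := by
  unfold labels
  split_ifs <;> omega

theorem alternating_of_isChain [DecidableEq V] (hG : ∀ a b, G.Adj a b → (a ∈ X ↔ b ∉ X))
    (hSX : S ⊆ X) {p : V} (hp : p ∈ X) : ∀ {M : List V} {p' : V}, p' ∈ X → (p' :: (M ++ [p])).IsChain G.Adj →
      Alternating (kind X S) M
  | [], p', hp', h => by
    simp only [List.nil_append, List.isChain_cons_cons] at h
    exact absurd hp ((hG _ _ h.1).1 hp')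
  | y :: M, p', hp', h => by
    have hy : y ∉ X := (hG _ _ (List.isChain_cons_cons.1 h).1).1 hp'
    have hy' : kind X S y = .yy := by
      unfold kind
      rw [if_neg fun h => hy (hSX h), if_neg hy]
    cases M with
    | nil => exact .single hy'
    | cons x M =>
      have h₁ := (List.isChain_cons_cons.1 h).2
      have hx : x ∈ X := by
        have := hG _ _ (List.isChain_cons_cons.1 h₁).1
        tauto
      refine .cons hy' ?_ (alternating_of_isChain hG hSX hp hx (List.isChain_cons_cons.1 h₁).2)
      unfold kind
      split_ifs <;> rfl

theorem kind_of_mem [DecidableEq V] {v : V} (hv : v ∈ S) : kind X S v = .ss := if_pos hv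

variable [DecidableRel G.Adj]

/-- A label missing at a vertex is an edge missing between the vertex and the hexagon. -/
theorem loss_add_le {u z : ℕ → V} (hG : ∀ a b, G.Adj a b → (a ∈ X ↔ b ∉ X))
    (hu : ∀ t ∈ [1, 2, 4], u t ∈ X) (hz : ∀ t ∈ [1, 2, 4], z t ∉ X) (v : V) :
    loss (labels G u z) v + ((if G.Adj (u 1) v then 1 else 0) + (if G.Adj (u 2) v then 1 else 0) +
      (if G.Adj (u 4) v then 1 else 0) + ((if G.Adj (z 1) v then 1 else 0) +
      (if G.Adj (z 2) v then 1 else 0) + (if G.Adj (z 4) v then 1 else 0))) ≤ 3 := by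
  have key : ∀ t ∈ [1, 2, 4], ¬ (G.Adj (u t) v ∧ G.Adj (z t) v) := fun t ht ⟨h, h'⟩ =>
    hz t ht ((hG _ _ h').2 ((hG _ _ h).1 (hu t ht)))
  have h₁ := key 1 (by simp)
  have h₂ := key 2 (by simp)
  have h₄ := key 4 (by simp)
  unfold loss labels weight HasLabel
  by_cases a₁ : G.Adj (u 1) v <;> by_cases a₂ : G.Adj (u 2) v <;> by_cases a₄ : G.Adj (u 4) v <;>
    by_cases b₁ : G.Adj (z 1) v <;> by_cases b₂ : G.Adj (z 2) v <;>
    by_cases b₄ : G.Adj (z 4) v <;> simp_all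

theorem totalLoss_add_countP_le {u z : ℕ → V} (hG : ∀ a b, G.Adj a b → (a ∈ X ↔ b ∉ X))
    (hu : ∀ t ∈ [1, 2, 4], u t ∈ X) (hz : ∀ t ∈ [1, 2, 4], z t ∉ X) (D : List V) :
    totalLoss (labels G u z) D + (D.countP (G.Adj (u 1) ·) + D.countP (G.Adj (u 2) ·) +
      D.countP (G.Adj (u 4) ·) + (D.countP (G.Adj (z 1) ·) + D.countP (G.Adj (z 2) ·) +
      D.countP (G.Adj (z 4) ·))) ≤ 3 * D.length := by
  induction D with
  | nil => simp [totalLoss]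
  | cons v D ih =>
    have := loss_add_le hG hu hz v
    simp only [List.countP_cons, totalLoss_cons, List.length_cons, decide_eq_true_eq]
    omega

variable [DecidableEq V]

theorem Hexagon.two_mul_countP_le {C D : List V} {u z : ℕ → V} (h : Hexagon G X S C u z)
    (hG : ∀ a b, G.Adj a b → (a ∈ X ↔ b ∉ X)) (hSX : S ⊆ X) (hmin : Minimal G S C D)
    {p' p : V} {R : List V} (hR : IsCycleWord G (p' :: R)) (hD : (p' :: R).Perm D)
    (hp' : p' ∈ S) (hp : p ∈ S) (hpR : p ∈ R) :
    2 * (D.countP (G.Adj (u 1) ·) + D.countP (G.Adj (u 2) ·) + D.countP (G.Adj (u 4) ·) +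
      (D.countP (G.Adj (z 1) ·) + D.countP (G.Adj (z 2) ·) + D.countP (G.Adj (z 4) ·))) ≤
      3 * D.length := by
  obtain ⟨M, L, rfl⟩ := List.append_of_mem hpR
  have hM : Alternating (kind X S) M := by
    refine alternating_of_isChain hG hSX (hSX hp) (hSX hp') (hR.isChain.infix ⟨[], L, ?_⟩)
    simp
  have hL : Alternating (kind X S) L := by
    have : (p :: L ++ p' :: M).IsChain G.Adj := (IsCycleWord.rotate (A := p' :: M) hR).isChain
    refine alternating_of_isChain hG hSX (hSX hp') (hSX hp) (this.infix ⟨[], M, ?_⟩)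
    simp
  have hle := three_mul_length_le (labels_lt u z) (cyclic_readable G D)
    (h.not_forall₂ hG hSX hmin) (kind_of_mem hp') (kind_of_mem hp) hM hL
    ⟨_, hR, hD, List.Sublist.refl _⟩
  have hsum := totalLoss_add_countP_le hG (fun t ht => hSX (h.mem t ht)) h.notMem
    (p' :: M ++ p :: L)
  simp only [List.cons_append, hD.countP_eq, hD.length_eq] at hle hsum
  omega

end Counting

section Averages

/-- If all sums over three elements are small, then so is the sum over all elements. -/
theorem two_mul_sum_le_of_triples {α : Type*} [DecidableEq α] {f : α → ℕ} {n k : ℕ} :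
    ∀ {T : Finset α}, T.card = k + 3 → (∀ a ∈ T, ∀ b ∈ T, ∀ c ∈ T, a ≠ b → a ≠ c → b ≠ c →
      2 * (f a + f b + f c) ≤ 3 * n) → 2 * ∑ a ∈ T, f a ≤ (k + 3) * n := by
  induction k with
  | zero =>
    intro T hT h
    obtain ⟨a, b, c, hab, hac, hbc, rfl⟩ := Finset.card_eq_three.1 hT
    have := h a (by simp) b (by simp) c (by simp) hab hac hbc
    rw [Finset.sum_insert (by simp [hab, hac]), Finset.sum_pair hbc]
    linarith
  | succ k ih =>
    intro T hT h
    obtain ⟨x, hx, hxn⟩ : ∃ x ∈ T, 2 * f x ≤ n := by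
      by_contra! hc
      obtain ⟨a, ha, b, hb, c, hc', hab, hac, hbc⟩ := Finset.two_lt_card.1 (by omega : 2 < T.card)
      have := h a ha b hb c hc' hab hac hbc
      have := hc a ha
      have := hc b hb
      have := hc c hc'
      omega
    have := ih (T := T.erase x) (by rw [Finset.card_erase_of_mem hx, hT]; rfl)
      fun a ha b hb c hc =>
        h a (Finset.mem_of_mem_erase ha) b (Finset.mem_of_mem_erase hb) c
          (Finset.mem_of_mem_erase hc)
    rw [← Finset.add_sum_erase _ _ hx]
    linarith

end Averages

section Translation

variable {V : Type*} {G : SimpleGraph V}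

/-- Every cycle word comes from a cycle. -/
theorem IsCycleWord.exists_isCycle {A : List V} (h : IsCycleWord G A) :
    ∃ (v : V) (c : G.Walk v v), c.IsCycle ∧ c.length = A.length ∧ ∀ w, w ∈ c.support ↔ w ∈ A := by
  have hne : A ≠ [] := by
    rintro rfl
    simpa using h.length
  have hadj : G.Adj (A.getLast hne) (A.head hne) :=
    h.adj _ (by simp [List.getLast?_eq_some_getLast hne]) _ (by simp [List.head?_eq_some_head hne])
  have hlen := h.length
  have hl : (SimpleGraph.Walk.cons hadj (.ofSupport A hne h.isChain)).length = A.length := by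
    rw [SimpleGraph.Walk.length_cons, SimpleGraph.Walk.length_ofSupport]
    omega
  refine ⟨_, .cons hadj (.ofSupport A hne h.isChain), ?_, hl, fun w => ?_⟩
  · rw [SimpleGraph.Walk.isCycle_iff_isPath_tail_and_le_length]
    refine ⟨?_, by omega⟩
    rw [SimpleGraph.Walk.isPath_def,
      SimpleGraph.Walk.support_tail_of_not_nil _ SimpleGraph.Walk.not_nil_cons,
      SimpleGraph.Walk.support_cons, List.tail_cons, SimpleGraph.Walk.support_ofSupport]
    exact h.nodup
  · rw [SimpleGraph.Walk.support_cons, SimpleGraph.Walk.support_ofSupport, List.mem_cons]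
    exact or_iff_right_of_imp fun h => h ▸ List.getLast_mem hne

variable [DecidableEq V]

theorem toFinset_support_tail {v : V} {c : G.Walk v v} (hc : c.IsCycle) :
    c.support.tail.toFinset = c.support.toFinset := by
  ext w
  simp [mem_support_tail_iff hc]

theorem card_filter_toFinset {L : List V} (hL : L.Nodup) (q : V → Prop) [DecidablePred q] :
    (L.toFinset.filter q).card = L.countP (q ·) := by
  rw [List.countP_eq_length_filter, ← List.toFinset_card_of_nodup (hL.filter _),
    List.toFinset_filter]
  simp

theorem card_inter_toFinset {L : List V} (hL : L.Nodup) (S : Finset V) :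
    (S ∩ L.toFinset).card = L.countP (· ∈ S) := by
  rw [Finset.inter_comm, ← Finset.filter_mem_eq_inter, card_filter_toFinset hL]

theorem minimal_of_walks {S : Finset V} {v₁ v₂ : V} {c₁ : G.Walk v₁ v₁} {c₂ : G.Walk v₂ v₂}
    (hdisj : Disjoint c₁.support.toFinset c₂.support.toFinset)
    (hmin : ∀ (w₁ w₂ : V) (d₁ : G.Walk w₁ w₁) (d₂ : G.Walk w₂ w₂),
      d₁.IsCycle → d₂.IsCycle →
      2 ≤ (S ∩ d₁.support.toFinset).card → 2 ≤ (S ∩ d₂.support.toFinset).card →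
      Disjoint d₁.support.toFinset d₂.support.toFinset →
      c₁.length + c₂.length ≤ d₁.length + d₂.length) :
    Minimal G S c₁.support.tail c₂.support.tail where
  disjoint := fun w h₁ h₂ => Finset.disjoint_left.1 hdisj (by simpa using List.mem_of_mem_tail h₁)
    (by simpa using List.mem_of_mem_tail h₂)
  le A B hA hB hAB hAS hBS := by
    obtain ⟨w₁, d₁, hd₁, hl₁, hm₁⟩ := hA.exists_isCycle
    obtain ⟨w₂, d₂, hd₂, hl₂, hm₂⟩ := hB.exists_isCycle
    have h₁ : d₁.support.toFinset = A.toFinset := by ext; simp [hm₁]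
    have h₂ : d₂.support.toFinset = B.toFinset := by ext; simp [hm₂]
    have := hmin w₁ w₂ d₁ d₂ hd₁ hd₂ (by rwa [h₁, card_inter_toFinset hA.nodup])
      (by rwa [h₂, card_inter_toFinset hB.nodup]) (by
        rw [h₁, h₂, List.disjoint_toFinset_iff_disjoint]
        exact hAB)
    simpa [hl₁, hl₂] using this

end Translation

end TwoCycles

/-- Lemma 6: if {C₁, C₂} is a minimal system with |S ∩ V(C₁)| = t,
|S ∩ V(C₂)| = s, t ≥ s ≥ 2, t ≥ 3, then
e((S ∩ V(C₁)) ∪ (S ∩ V(C₁))⁺, C₂) ≤ t·|C₂|/2, where ⁺ denotes the successor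
on C₁. -/
theorem edges_from_S_and_successors {V : Type*} [Fintype V] [DecidableEq V]
    (G : SimpleGraph V) [DecidableRel G.Adj]
    (X Y S : Finset V) (t s : ℕ) (hts : s ≤ t) (hs : 2 ≤ s) (ht : 3 ≤ t)
    (hdisj : Disjoint X Y) (hcover : X ∪ Y = Finset.univ)
    (hbip : ∀ u v : V, G.Adj u v → (u ∈ X ∧ v ∈ Y) ∨ (u ∈ Y ∧ v ∈ X))
    (hSX : S ⊆ X)
    (v₁ v₂ : V) (c₁ : G.Walk v₁ v₁) (c₂ : G.Walk v₂ v₂)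
    (hc₁ : c₁.IsCycle) (hc₂ : c₂.IsCycle)
    (hdisjc : Disjoint c₁.support.toFinset c₂.support.toFinset)
    (ht' : (S ∩ c₁.support.toFinset).card = t)
    (hs' : (S ∩ c₂.support.toFinset).card = s)
    -- minimality: no two disjoint feasible cycles of smaller total order
    (hmin : ∀ (w₁ w₂ : V) (d₁ : G.Walk w₁ w₁) (d₂ : G.Walk w₂ w₂),
      d₁.IsCycle → d₂.IsCycle →
      2 ≤ (S ∩ d₁.support.toFinset).card → 2 ≤ (S ∩ d₂.support.toFinset).card →
      Disjoint d₁.support.toFinset d₂.support.toFinset →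
      c₁.length + c₂.length ≤ d₁.length + d₂.length)
    -- σ is the successor map along the orientation of C₁
    (σ : V → V)
    (hσ : ∀ u ∈ c₁.support, ∃ d ∈ c₁.darts, d.toProd = (u, σ u)) :
    2 * ∑ w ∈ (S ∩ c₁.support.toFinset) ∪ (S ∩ c₁.support.toFinset).image σ,
        (c₂.support.toFinset.filter (fun u => G.Adj w u)).card ≤
      t * c₂.length := by
  have hG : ∀ a b, G.Adj a b → (a ∈ X ↔ b ∉ X) := by
    intro a b h
    have : ∀ v, v ∈ X → v ∉ Y := fun v h => Finset.disjoint_left.1 hdisj h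
    rcases hbip a b h with ⟨h₁, h₂⟩ | ⟨h₁, h₂⟩
    · exact iff_of_true h₁ fun h => this _ h h₂
    · exact iff_of_false (fun h => this _ h h₁) (not_not_intro h₂)
  have hw := TwoCycles.isCycleWord_support_tail hc₂
  obtain ⟨p', hp', p, hp, hne⟩ :=
    Finset.one_lt_card.1 (by omega : 1 < (S ∩ c₂.support.toFinset).card)
  simp only [Finset.mem_inter, List.mem_toFinset] at hp' hp
  obtain ⟨R, hR, hperm, -⟩ := TwoCycles.exists_cycleWord hc₂ hp'.2
  have hpR : p ∈ R := (List.mem_cons.1 (hperm.mem_iff.2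
    ((TwoCycles.mem_support_tail_iff hc₂).2 hp.2))).resolve_left hne.symm
  have hlen : c₂.support.tail.length = c₂.length := by simp
  rw [← TwoCycles.toFinset_support_tail hc₂]
  simp only [TwoCycles.card_filter_toFinset hw.nodup]
  set f : V → ℕ := fun w => c₂.support.tail.countP (G.Adj w ·)
  set T := S ∩ c₁.support.toFinset with hT
  have hsum : ∑ w ∈ T ∪ T.image σ, f w ≤ ∑ w ∈ T, (f w + f (σ w)) := by
    have h₁ := Finset.sum_union_inter (s₁ := T) (s₂ := T.image σ) (f := f)
    have h₂ := Finset.sum_image_le_of_nonneg (s := T) (g := σ) (f := f) fun _ _ => Nat.zero_le _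
    rw [Finset.sum_add_distrib]
    omega
  refine (Nat.mul_le_mul_left 2 hsum).trans ?_
  obtain ⟨k, rfl⟩ : ∃ k, t = k + 3 := ⟨t - 3, by omega⟩
  refine TwoCycles.two_mul_sum_le_of_triples ht' fun a ha b hb c hc hab hac hbc => ?_
  simp only [hT, Finset.mem_inter, List.mem_toFinset] at ha hb hc
  obtain ⟨u, z, h, hf⟩ := TwoCycles.exists_hexagon hc₁ hG hSX hσ ha.1 hb.1 hc.1 ha.2 hb.2 hc.2
    hab hac hbc
  rw [← hf f, ← hlen]
  exact h.two_mul_countP_le hG hSX (TwoCycles.minimal_of_walks hdisjc hmin) hR hperm hp'.1 hp.1 hpR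
end

section
/- Let G be a 2-connected balanced bipartite graph of order 2n with bipartition (X,Y) and S ⊆ X. If every nonadjacent pair x ∈ S, y ∈ Y (and every nonadjacent pair x ∈ X, y ∈ Y ∩ S when S meets Y) satisfies d(x) + d(y) ≥ n+1, then G has a cycle containing all vertices of S. -/
namespace SimpleGraph

open Finset

variable {V : Type*} {G : SimpleGraph V} {X Y S : Finset V}

/-- The graph `G` has a cycle through all vertices of `S`. -/
def IsCyclable (G : SimpleGraph V) (S : Finset V) : Prop :=
  ∃ (u : V) (c : G.Walk u u), c.IsCycle ∧ ∀ s ∈ S, s ∈ c.support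

lemma IsBipartiteWith.notMem_right (hG : G.IsBipartiteWith X Y) {v : V} (hx : v ∈ X) :
    v ∉ Y := fun hy ↦ Set.disjoint_left.1 hG.disjoint hx hy

lemma IsBipartiteWith.isCyclable_of_isPath (hG : G.IsBipartiteWith X Y) (hSX : S ⊆ X)
    (hS : 1 < #S) {x w : V} {p : G.Walk x w} (hp : p.IsPath)
    (hSp : ∀ s ∈ S, s ∈ p.support) (h : G.Adj w x) : G.IsCyclable S := by
  refine ⟨w, .cons h p, ?_, fun s hs ↦ by simp [hSp s hs]⟩
  rw [Walk.cons_isCycle_iff]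
  refine ⟨hp, fun he ↦ ?_⟩
  have hlen := hp.length_eq_one_of_mem_edges (Sym2.eq_swap ▸ he)
  have hsupp : ∀ s ∈ S, s = x ∨ s = w := by
    intro s hs
    have := hSp s hs
    cases p with
    | nil => simp at hlen
    | cons h' q =>
      cases q with
      | nil => simpa using this
      | cons h'' r => simp at hlen
  obtain ⟨s, hs, t, ht, hst⟩ := Finset.one_lt_card.1 hS
  have hxw := hG.mem_of_adj h
  have h1 := hG.notMem_right (hSX hs)
  have h2 := hG.notMem_right (hSX ht)
  simp only [mem_coe] at hxw
  grind

/-- Every walk meeting `S` splits at its last vertex in `S`. -/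
lemma Walk.exists_append_last : ∀ {x y : V} (p : G.Walk x y), (∃ s ∈ S, s ∈ p.support) →
    ∃ s ∈ S, ∃ (p₁ : G.Walk x s) (p₂ : G.Walk s y), p = p₁.append p₂ ∧
      ∀ z ∈ p₂.support.tail, z ∉ S
  | x, _, .nil, ⟨s, hs, hsp⟩ => ⟨x, by simp_all, .nil, .nil, rfl, by simp⟩
  | x, y, .cons h p, ⟨s, hs, hsp⟩ => by
    by_cases hp : ∃ s ∈ S, s ∈ p.support
    · obtain ⟨t, ht, p₁, p₂, rfl, h2⟩ := exists_append_last p hp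
      exact ⟨t, ht, .cons h p₁, p₂, rfl, h2⟩
    · push Not at hp
      have : s = x := by
        have := hp s hs
        simp_all
      subst this
      exact ⟨s, hs, .nil, .cons h p, rfl, fun z hz hzS ↦ hp z hzS (by simpa using hz)⟩

variable [DecidableEq V]

/-- If no edge `uw` of a path has `u ∈ M` and `w ∈ N`, then the path has few vertices
in `N` and `M`. -/
lemma Walk.card_add_card_le_of_split (hG : G.IsBipartiteWith X Y) {N M : Finset V}
    (hN : N ⊆ Y) (hM : M ⊆ X) :
    ∀ {x y : V} (p : G.Walk x y), p.IsPath → y ∈ Y →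
      (∀ (u w : V) (p₁ : G.Walk x u) (h : G.Adj u w) (p₂ : G.Walk w y),
        p = p₁.append (.cons h p₂) → u ∈ M → w ∉ N) →
      #(N ∩ p.support.tail.toFinset) + #(M ∩ p.support.toFinset) ≤ #(X ∩ p.support.toFinset)
  | x, _, .nil, _, hy, _ => by
    have : x ∉ M := fun h ↦ hG.notMem_right (hM h) hy
    simp [this]
  | x, y, .cons (v := v) h p, hp, hy, hsplit => by
    rw [Walk.cons_isPath_iff] at hp
    have ih := card_add_card_le_of_split hG hN hM p hp.1 hy fun u w p₁ h' p₂ hpp ↦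
      hsplit u w (.cons h p₁) h' p₂ (by simp [hpp])
    have hxv := hsplit x v .nil h p rfl
    have hx : x ∉ p.support.toFinset := by simpa using hp.2
    have hv : v ∉ p.support.tail.toFinset := by
      have := hp.1.support_nodup
      rw [← Walk.cons_tail_support] at this
      simpa using (List.nodup_cons.1 this).1
    have hsv : p.support.toFinset = insert v p.support.tail.toFinset := by
      rw [← List.toFinset_cons, Walk.cons_tail_support]
    have hadj := hG.mem_of_adj h
    simp only [mem_coe] at hadj
    simp only [Walk.support_cons, List.tail_cons, List.toFinset_cons]
    have hcard : ∀ (A B : Finset V) (a : V), a ∉ B →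
        #(A ∩ insert a B) = #(A ∩ B) + if a ∈ A then 1 else 0 := by
      intro A B a ha
      split_ifs with h
      · rw [inter_insert_of_mem h, card_insert_of_notMem (by simp [ha])]
      · rw [inter_insert_of_notMem h, add_zero]
    rw [hcard M _ x hx, hcard X _ x hx, hsv, hcard N _ v hv, ← hsv]
    have h3 : v ∈ X → v ∉ Y := hG.notMem_right
    have h4 : x ∈ X → x ∉ Y := hG.notMem_right
    have := @hN v
    have := @hM x
    grind

lemma IsBipartiteWith.card_inter_support (hG : G.IsBipartiteWith X Y) :
    ∀ {x y : V} (p : G.Walk x y), p.IsPath → y ∈ Y →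
      #(Y ∩ p.support.toFinset) = #(X ∩ p.support.toFinset) + if x ∈ X then 0 else 1
  | x, _, .nil, _, hy => by
    have : x ∉ X := fun h ↦ hG.notMem_right h hy
    simp [this, hy]
  | x, y, .cons (v := v) h p, hp, hy => by
    rw [Walk.cons_isPath_iff] at hp
    have ih := card_inter_support hG p hp.1 hy
    have hx : x ∉ p.support.toFinset := by simpa using hp.2
    have hadj := hG.mem_of_adj h
    simp only [mem_coe] at hadj
    simp only [Walk.support_cons, List.toFinset_cons]
    have h3 : v ∈ X → v ∉ Y := hG.notMem_right
    have h4 : x ∈ X → x ∉ Y := hG.notMem_right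
    by_cases hxX : x ∈ X
    · rw [inter_insert_of_mem hxX, inter_insert_of_notMem (h4 hxX),
        card_insert_of_notMem (by simp [hx])]
      grind
    · have hxY : x ∈ Y := by tauto
      rw [inter_insert_of_mem hxY, inter_insert_of_notMem hxX,
        card_insert_of_notMem (by simp [hx])]
      grind

/-- If a path through `S` does not close up to a cycle through `S`, then its ends
have few neighbours on it. -/
lemma IsBipartiteWith.card_neighborFinset_inter_le [Fintype V] [DecidableRel G.Adj]
    (hG : G.IsBipartiteWith X Y) (hSX : S ⊆ X) (hS : 1 < #S) (hnc : ¬ G.IsCyclable S)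
    {x y : V} (hx : x ∈ X) (hy : y ∈ Y) {p : G.Walk x y} (hp : p.IsPath)
    (hSp : ∀ s ∈ S, s ∈ p.support) :
    #(G.neighborFinset x ∩ p.support.toFinset) + #(G.neighborFinset y ∩ p.support.toFinset) ≤
      #(X ∩ p.support.toFinset) := by
  have hNx : G.neighborFinset x ⊆ Y := fun v hv ↦ by
    have := hG.mem_of_adj ((mem_neighborFinset ..).1 hv)
    have := hG.notMem_right hx
    simp_all
  have hNy : G.neighborFinset y ⊆ X := fun v hv ↦ by
    have := hG.mem_of_adj ((mem_neighborFinset ..).1 hv)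
    have : y ∈ X → y ∉ Y := hG.notMem_right
    simp_all
  have key := Walk.card_add_card_le_of_split hG hNx hNy p hp hy ?_
  · have : G.neighborFinset x ∩ p.support.toFinset =
        G.neighborFinset x ∩ p.support.tail.toFinset := by
      conv_lhs => rw [← Walk.cons_tail_support]
      rw [List.toFinset_cons, inter_insert_of_notMem (by simp)]
    rwa [this]
  · rintro u w p₁ h p₂ rfl hu hw
    have hperm : (p₁.append (.cons ((mem_neighborFinset ..).1 hu).symm p₂.reverse)).support.Perm
        (p₁.append (.cons h p₂)).support := by
      simp only [Walk.support_append, Walk.support_cons, List.tail_cons, Walk.support_reverse]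
      exact List.Perm.append_left _ (List.reverse_perm _)
    refine hnc (hG.isCyclable_of_isPath hSX hS
      (p := p₁.append (.cons ((mem_neighborFinset ..).1 hu).symm p₂.reverse)) ?_ ?_
      ((mem_neighborFinset ..).1 hw).symm)
    · rw [Walk.isPath_def, hperm.nodup_iff]
      exact hp.support_nodup
    · intro s hs
      exact hperm.mem_iff.2 (hSp s hs)

lemma IsBipartiteWith.isCyclable_of_path [Fintype V] [DecidableRel G.Adj] {n : ℕ}
    (hG : G.IsBipartiteWith X Y) (hX : #X = n) (hY : #Y = n) (hSX : S ⊆ X) (hS : 1 < #S)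
    (hdeg : ∀ s ∈ S, ∀ y ∈ Y, ¬ G.Adj s y → n + 1 ≤ G.degree s + G.degree y)
    {x y : V} (hx : x ∈ S) (hy : y ∈ Y) {p : G.Walk x y} (hp : p.IsPath)
    (hSp : ∀ s ∈ S, s ∈ p.support) : G.IsCyclable S := by
  by_contra hnc
  have hcyc : ∀ {u v : V} (q : G.Walk u v), q.IsPath → (∀ s ∈ S, s ∈ q.support) →
      ¬ G.Adj v u := fun q hq hSq h ↦ hnc (hG.isCyclable_of_isPath hSX hS hq hSq h)
  have hNX : ∀ {u v : V}, u ∈ X → G.Adj u v → v ∈ Y := by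
    intro u v hu h
    have := hG.mem_of_adj h
    have := hG.notMem_right hu
    simp_all
  have hNY : ∀ {u v : V}, u ∈ Y → G.Adj u v → v ∈ X := by
    intro u v hu h
    have := hG.mem_of_adj h
    have : u ∈ X → u ∉ Y := hG.notMem_right
    simp_all
  set P := p.support.toFinset with hP
  set A := G.neighborFinset x \ P with hA
  set B := G.neighborFinset y \ P with hB
  have hAB : n + 1 ≤ #A + #B + #(X ∩ P) := by
    have h1 := hdeg x hx y hy fun h ↦ hcyc p hp hSp h.symm
    have h2 : #(G.neighborFinset x ∩ P) + #(G.neighborFinset y ∩ P) ≤ #(X ∩ P) :=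
      hG.card_neighborFinset_inter_le hSX hS hnc (hSX hx) hy hp hSp
    have h3 : #A + _ = _ := card_sdiff_add_card_inter (G.neighborFinset x) P
    have h4 : #B + _ = _ := card_sdiff_add_card_inter (G.neighborFinset y) P
    rw [card_neighborFinset_eq_degree] at h3 h4
    omega
  have hXP := card_sdiff_add_card_inter X P
  have hYP := card_sdiff_add_card_inter Y P
  have hbal := hG.card_inter_support p hp hy
  rw [if_pos (hSX hx), ← hP] at hbal
  have hAY : A ⊆ Y \ P := sdiff_subset_sdiff
    (fun v hv ↦ hNX (hSX hx) ((mem_neighborFinset ..).1 hv)) le_rfl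
  have hBX : B ⊆ X \ P := sdiff_subset_sdiff
    (fun v hv ↦ hNY hy ((mem_neighborFinset ..).1 hv)) le_rfl
  have hAc := card_le_card hAY
  have hBc := card_le_card hBX
  obtain ⟨a, ha⟩ : A.Nonempty := by
    rw [← card_pos]; omega
  obtain ⟨s, hs, p₁, p₂, hpp, hlast⟩ := p.exists_append_last ⟨x, hx, hSp x hx⟩
  have hxa : G.Adj x a := by simpa using (mem_sdiff.1 ha).1
  have haP : a ∉ p.support := by simpa [hP] using (mem_sdiff.1 ha).2
  have hp₁ : p₁.IsPath := by subst hpp; exact hp.of_append_left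
  have hp₂ : p₂.IsPath := by subst hpp; exact hp.of_append_right
  have hmem : ∀ z, z ∈ p.support ↔ z ∈ p₁.support ∨ z ∈ p₂.support := by
    subst hpp; simp [Walk.mem_support_append_iff]
  have hSp₁ : ∀ t ∈ S, t ∈ p₁.support := by
    intro t ht
    have := (hmem t).1 (hSp t ht)
    have h2 := hlast t
    rw [Walk.mem_support_iff p₂] at this
    have := p₁.end_mem_support
    grind
  have hdisj : ∀ z, z ∈ p₁.support → z ∈ p₂.support.tail → False := by
    have := hp.support_nodup
    rw [hpp, Walk.support_append, List.nodup_append'] at this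
    exact fun z h1 h2 ↦ this.2.2 h1 h2
  have hR : (Walk.cons hxa.symm p₁).IsPath := by
    rw [Walk.cons_isPath_iff]
    exact ⟨hp₁, fun h ↦ haP ((hmem a).2 (.inl h))⟩
  have hSR : ∀ t ∈ S, t ∈ (Walk.cons hxa.symm p₁).support := fun t ht ↦ by
    simp [hSp₁ t ht]
  set R := (Walk.cons hxa.symm p₁).support.toFinset with hRdef
  have haY : a ∈ Y := hNX (hSX hx) hxa
  have hcross := hG.card_neighborFinset_inter_le hSX hS hnc (hSX hs) haY hR.reverse
    (by simpa only [Walk.support_reverse, List.mem_reverse] using hSR)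
  rw [Walk.support_reverse, List.toFinset_reverse, ← hRdef] at hcross
  have hXR : X ∩ R = X ∩ p₁.support.toFinset := by
    rw [hRdef, Walk.support_cons, List.toFinset_cons,
      inter_insert_of_notMem fun h ↦ hG.notMem_right h haY]
  have hsum := hdeg s hs a haY (hcyc _ hR hSR)
  have hXcount : #(X ∩ P) + 1 = #(X ∩ p₁.support.toFinset) + #(X ∩ p₂.support.toFinset) := by
    rw [← card_union_add_card_inter, ← inter_union_distrib_left]
    have h1 : P = p₁.support.toFinset ∪ p₂.support.toFinset := by
      ext z; simp [hP, hmem]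
    have h2 : X ∩ p₁.support.toFinset ∩ (X ∩ p₂.support.toFinset) = {s} := by
      ext z
      simp only [mem_inter, List.mem_toFinset, mem_singleton]
      constructor
      · rintro ⟨⟨-, h⟩, -, h'⟩
        rw [Walk.mem_support_iff] at h'
        exact h'.resolve_right (hdisj z h)
      · rintro rfl
        simp [hSX hs]
    rw [h1, h2, card_singleton]
  have hYcount := hG.card_inter_support p₂ hp₂ hy
  rw [if_pos (hSX hs), add_zero] at hYcount
  have hsN : G.neighborFinset s ⊆
      (G.neighborFinset s ∩ R) ∪ (Y ∩ p₂.support.toFinset) ∪ ((Y \ P) \ A) := by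
    intro z hz
    have hsz : G.Adj s z := by simpa using hz
    have hzY := hNX (hSX hs) hsz
    by_cases hzP : z ∈ p.support
    · rcases (hmem z).1 hzP with h | h
      · simp [hsz, hRdef, h]
      · simp [hzY, h]
    · have hzA : z ∉ A := by
        intro hzA
        have hxz : G.Adj x z := by simpa using (mem_sdiff.1 hzA).1
        refine hcyc (.cons hxz.symm p₁) ?_ (fun t ht ↦ by simp [hSp₁ t ht]) hsz
        rw [Walk.cons_isPath_iff]
        exact ⟨hp₁, fun h ↦ hzP ((hmem z).2 (.inl h))⟩
      simp only [mem_union, mem_sdiff]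
      exact .inr ⟨⟨hzY, by simpa [hP] using hzP⟩, hzA⟩
  have haN : G.neighborFinset a ⊆ (G.neighborFinset a ∩ R) ∪ ((X \ P) \ B) := by
    intro z hz
    have haz : G.Adj a z := by simpa using hz
    have hzX := hNY haY haz
    by_cases hzP : z ∈ p.support
    · rcases (hmem z).1 hzP with h | h
      · simp [haz, hRdef, h]
      · exfalso
        obtain ⟨q, q', rfl⟩ := Walk.mem_support_iff_exists_append.1 h
        have hpath : (p₁.append q).IsPath := by
          rw [hpp, Walk.append_assoc] at hp
          exact hp.of_append_left
        refine hcyc (.cons hxa.symm (p₁.append q)) ?_ (fun t ht ↦ ?_) haz.symm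
        · rw [Walk.cons_isPath_iff]
          refine ⟨hpath, fun h ↦ haP ?_⟩
          rw [hpp, Walk.append_assoc, Walk.mem_support_append_iff]
          exact .inl h
        · simp [Walk.mem_support_append_iff, hSp₁ t ht]
    · have hzB : z ∉ B := by
        intro hzB
        have hyz : G.Adj y z := by simpa using (mem_sdiff.1 hzB).1
        refine hcyc (.cons hxa.symm (p.concat hyz)) ?_ (fun t ht ↦ ?_) haz.symm
        · rw [Walk.cons_isPath_iff]
          refine ⟨hp.concat hzP hyz, ?_⟩
          simp [Walk.support_concat, haP, haz.ne]
        · simp [Walk.support_concat, hSp t ht]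
      simp only [mem_union, mem_sdiff]
      exact .inr ⟨⟨hzX, by simpa [hP] using hzP⟩, hzB⟩
  have hs1 := (card_le_card hsN).trans ((card_union_le _ _).trans
    (Nat.add_le_add_right (card_union_le _ _) _))
  have ha1 := (card_le_card haN).trans (card_union_le _ _)
  rw [card_neighborFinset_eq_degree, card_sdiff_of_subset hAY] at hs1
  rw [card_neighborFinset_eq_degree, card_sdiff_of_subset hBX] at ha1
  rw [hXR] at hcross
  omega

lemma exists_isPath_of_forall_adj (hXY : Disjoint S Y) (hSY : #S ≤ #Y)
    (hadj : ∀ s ∈ S, ∀ y ∈ Y, G.Adj s y) (T : Finset V) : T ⊆ S → T.Nonempty →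
    ∃ x ∈ S, ∃ y ∈ Y, ∃ p : G.Walk x y, p.IsPath ∧ (∀ s ∈ T, s ∈ p.support) ∧
      (∀ v ∈ p.support, v ∈ T ∪ Y) ∧ #(Y ∩ p.support.toFinset) ≤ #T := by
  induction T using Finset.induction_on with
  | empty => simp
  | insert s T hsT ih =>
    intro hTS _
    rw [insert_subset_iff] at hTS
    have hsY : s ∉ Y := Finset.disjoint_left.1 hXY hTS.1
    have hT : #T + 1 ≤ #S := by
      rw [← card_insert_of_notMem hsT]
      exact card_le_card (insert_subset hTS.1 hTS.2)
    rcases T.eq_empty_or_nonempty with rfl | hne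
    · obtain ⟨y, hy⟩ : Y.Nonempty := by rw [← card_pos]; omega
      refine ⟨s, hTS.1, y, hy, .cons (hadj s hTS.1 y hy) .nil, ?_, ?_, ?_, ?_⟩
      · simp [(hadj s hTS.1 y hy).ne]
      · simp
      · simp [hy]
      · simp [inter_insert_of_notMem hsY, hy]
    · obtain ⟨x, hx, y, hy, p, hp, hTp, hpT, hc⟩ := ih hTS.2 hne
      obtain ⟨z, hzY, hzp⟩ : ∃ z ∈ Y, z ∉ Y ∩ p.support.toFinset :=
        exists_mem_notMem_of_card_lt_card (by omega)
      have hzp' : z ∉ p.support := by simpa [hzY] using hzp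
      have hsz := hadj s hTS.1 z hzY
      refine ⟨s, hTS.1, y, hy, .cons hsz (.cons (hadj x hx z hzY).symm p), ?_, ?_, ?_, ?_⟩
      · simp only [Walk.cons_isPath_iff, hp, hzp', Walk.support_cons, List.mem_cons, not_or]
        refine ⟨by simp, hsz.ne, fun h ↦ ?_⟩
        have := hpT s h
        simp_all
      · simp only [mem_insert, Walk.support_cons, List.mem_cons]
        grind
      · simp only [Walk.support_cons, List.mem_cons]
        grind
      · rw [card_insert_of_notMem hsT]
        simp only [Walk.support_cons, List.toFinset_cons]
        rw [inter_insert_of_notMem hsY, inter_insert_of_mem hzY]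
        exact (card_insert_le _ _).trans (by omega)

lemma Walk.IsCycle.exists_isPath_of_mem_edges {u x y : V} {c : G.Walk u u} (hc : c.IsCycle)
    (he : s(x, y) ∈ c.edges) :
    ∃ p : G.Walk x y, p.IsPath ∧ s(x, y) ∉ p.edges ∧ ∀ v ∈ c.support, v ∈ p.support := by
  have hx : x ∈ c.support := c.fst_mem_support_of_mem_edges he
  suffices H : ∀ d : G.Walk x x, d.IsCycle → d.snd = y →
      ∃ p : G.Walk x y, p.IsPath ∧ s(x, y) ∉ p.edges ∧ ∀ v ∈ d.support, v ∈ p.support by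
    have hd : (c.rotate x hx).IsCycle := by simpa using hc
    have hed : s(x, y) ∈ (c.rotate x hx).edges := (c.rotate_edges x hx).mem_iff.2 he
    have hmem : ∀ v ∈ c.support, v ∈ (c.rotate x hx).support := fun v hv ↦ by
      rwa [Walk.mem_support_rotate_iff]
    generalize c.rotate x hx = d at hd hed hmem
    by_cases h : d.snd = y
    · obtain ⟨p, h1, h2, h3⟩ := H d hd h
      exact ⟨p, h1, h2, fun v hv ↦ h3 v (hmem v hv)⟩
    · obtain ⟨p, h1, h2, h3⟩ := H d.reverse hd.reverse (by
        cases d with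
        | nil => simp at hed
        | cons h' q =>
          have hq := (Walk.cons_isCycle_iff _ _).1 hd
          have : s(x, y) ∈ q.edges := by
            simp only [Walk.edges_cons, List.mem_cons, Sym2.eq_iff] at hed
            rcases hed with (⟨-, h1⟩ | ⟨h1, h2⟩) | h
            · simp_all
            · simp_all
            · exact h
          have hnil : ¬ q.Nil := fun hn ↦ by
            rw [Walk.edges_eq_nil.2 hn] at this
            simp at this
          rw [Walk.snd_reverse, Walk.penultimate_cons_of_not_nil _ _ hnil,
            hq.1.eq_penultimate_of_mem_edges this])
      exact ⟨p, h1, h2, fun v hv ↦ h3 v (by simpa using hmem v hv)⟩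
  intro d hd hy
  cases d with
  | nil => simp at hd
  | cons h q =>
    have hq := (Walk.cons_isCycle_iff _ _).1 hd
    simp only [Walk.snd_cons] at hy
    subst hy
    refine ⟨q.reverse, hq.1.reverse, by simpa using hq.2, fun v hv ↦ ?_⟩
    simp only [Walk.support_cons, List.mem_cons] at hv
    rcases hv with rfl | hv
    · simp
    · simpa using hv

lemma isCyclable_of_one_lt_card [Fintype V] {n : ℕ}
    (hX : #X = n) (hY : #Y = n) (hSX : S ⊆ X) (hS : 1 < #S) (k : ℕ) :
    ∀ (G : SimpleGraph V) [DecidableRel G.Adj], G.IsBipartiteWith X Y →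
    (∀ s ∈ S, ∀ y ∈ Y, ¬ G.Adj s y → n + 1 ≤ G.degree s + G.degree y) →
    #{e ∈ S ×ˢ Y | ¬ G.Adj e.1 e.2} = k → G.IsCyclable S := by
  induction k with
  | zero =>
    intro G _ hG hdeg hk
    have hadj : ∀ s ∈ S, ∀ y ∈ Y, G.Adj s y := by
      intro s hs y hy
      by_contra h
      rw [card_eq_zero] at hk
      exact (hk ▸ notMem_empty (s, y)) (by simp [hs, hy, h])
    obtain ⟨x, hx, y, hy, p, hp, hSp, -⟩ := exists_isPath_of_forall_adj
      (Finset.disjoint_left.2 fun v hv ↦ hG.notMem_right (hSX hv))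
      (by rw [hY, ← hX]; exact card_le_card hSX) hadj S le_rfl (card_pos.1 (by omega))
    exact hG.isCyclable_of_isPath hSX hS hp hSp (hadj x hx y hy).symm
  | succ k ih =>
    intro G _ hG hdeg hk
    obtain ⟨⟨x, y⟩, hxy⟩ := card_pos.1 (by omega : 0 < #{e ∈ S ×ˢ Y | ¬ G.Adj e.1 e.2})
    simp only [mem_filter, mem_product] at hxy
    obtain ⟨⟨hx, hy⟩, hnadj⟩ := hxy
    have hne : x ≠ y := fun h ↦ hG.notMem_right (hSX hx) (h ▸ hy)
    have hle : G ≤ G ⊔ edge x y := le_sup_left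
    have hadj' : ∀ u v, (G ⊔ edge x y).Adj u v ↔ G.Adj u v ∨ s(u, v) = s(x, y) := by
      intro u v
      simp only [sup_adj, edge_adj, Sym2.eq_iff]
      grind
    let _ : DecidableRel (G ⊔ edge x y).Adj := Classical.decRel _
    obtain ⟨u, c, hc, hSc⟩ := ih (G ⊔ edge x y)
      ⟨hG.disjoint, fun v w h ↦ by
        rcases (hadj' v w).1 h with h | h
        · exact hG.mem_of_adj h
        · rw [Sym2.eq_iff] at h
          have := hSX hx
          simp only [mem_coe]
          grind⟩
      (fun s hs z hz h ↦ by
        have := hdeg s hs z hz fun h' ↦ h (hle h')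
        have h1 : G.degree s ≤ (G ⊔ edge x y).degree s := degree_le_of_le hle
        have h2 : G.degree z ≤ (G ⊔ edge x y).degree z := degree_le_of_le hle
        omega)
      (by
        have : ({e ∈ S ×ˢ Y | ¬ (G ⊔ edge x y).Adj e.1 e.2} : Finset (V × V)) =
            ({e ∈ S ×ˢ Y | ¬ G.Adj e.1 e.2} : Finset (V × V)).erase (x, y) := by
          ext ⟨u, v⟩
          have : u ∈ X → u ∉ Y := hG.notMem_right
          have := @hSX u
          simp only [mem_filter, mem_product, mem_erase, hadj', Sym2.eq_iff, ne_eq, Prod.mk.injEq]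
          grind
        rw [this, card_erase_of_mem (by simp [hx, hy, hnadj]), hk, Nat.add_sub_cancel])
    have hedge : ∀ {v w : V} (q : (G ⊔ edge x y).Walk v w), s(x, y) ∉ q.edges →
        ∀ e ∈ q.edges, e ∈ G.edgeSet := by
      intro v w q hq e he
      induction e with
      | _ a b =>
        refine ((hadj' a b).1 (q.adj_of_mem_edges he)).resolve_right fun h ↦ hq (h ▸ he)
    by_cases he : s(x, y) ∈ c.edges
    · obtain ⟨p, hp, hep, hpc⟩ := hc.exists_isPath_of_mem_edges he
      exact hG.isCyclable_of_path hX hY hSX hS hdeg hx hy (hp.transfer (hedge p hep))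
        (fun s hs ↦ by simpa using hpc s (hSc s hs))
    · exact ⟨u, c.transfer G (hedge c he), hc.transfer (hedge c he),
        fun s hs ↦ by simpa using hSc s hs⟩

/-- In a graph without cut vertices, every vertex lies on a cycle. -/
lemma exists_isCycle_of_connected_compl [Fintype V] (hcard : 3 ≤ Fintype.card V)
    (h2conn : ∀ w : V, (G.induce ({w}ᶜ : Set V)).Connected) (x : V) :
    ∃ c : G.Walk x x, c.IsCycle := by
  have hnbr : ∀ w, w ≠ x → ∃ y, G.Adj x y ∧ y ≠ w := by
    intro w hw
    obtain ⟨z, hz⟩ : ∃ z, z ∉ ({x, w} : Finset V) := by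
      by_contra! h
      have := card_le_card (fun v _ ↦ h v : (univ : Finset V) ⊆ {x, w})
      have := card_le_two (a := x) (b := w)
      rw [card_univ] at *
      omega
    simp only [mem_insert, mem_singleton, not_or] at hz
    have hxw : x ∈ ({w}ᶜ : Set V) := hw.symm
    have hzw : z ∈ ({w}ᶜ : Set V) := hz.2
    obtain ⟨q⟩ := (h2conn w).preconnected ⟨x, hxw⟩ ⟨z, hzw⟩
    cases q with
    | nil => simp at hz
    | @cons _ v _ h q => exact ⟨v, h, v.2⟩
  have : Nontrivial V := Fintype.one_lt_card_iff_nontrivial.1 (by omega)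
  obtain ⟨w, hw⟩ := exists_ne x
  obtain ⟨y, hy, -⟩ := hnbr w hw
  obtain ⟨z, hz, hzy⟩ := hnbr y hy.ne'
  obtain ⟨q⟩ := (h2conn x).preconnected ⟨y, hy.ne'⟩ ⟨z, hz.ne'⟩
  obtain ⟨r, hr⟩ : ∃ r : G.Walk y z, x ∉ r.support := by
    refine ⟨q.map (Embedding.induce ({x}ᶜ : Set V)).toHom, fun h ↦ ?_⟩
    erw [Walk.support_map, List.mem_map] at h
    obtain ⟨v, -, hv⟩ := h
    exact v.2 hv
  have hb : x ∉ r.bypass.support := fun h ↦ hr (r.support_bypass_subset_support h)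
  refine ⟨.cons hy (r.bypass.concat hz.symm), ?_⟩
  rw [Walk.cons_isCycle_iff]
  refine ⟨r.bypass_isPath.concat hb _, fun h ↦ ?_⟩
  simp only [Walk.edges_concat, List.concat_eq_append, List.mem_append, List.mem_singleton,
    Sym2.eq_iff] at h
  rcases h with h | ⟨h, -⟩ | ⟨-, h⟩
  · exact hb (Walk.fst_mem_support_of_mem_edges _ h)
  · exact hz.ne h
  · exact hzy h.symm

end SimpleGraph

/-- Theorem (Abderrezzak–Flandrin–Amar): a 2-connected balanced bipartite
graph G[X,Y] of order 2n with S ⊆ X and σ₁,₁(S) ≥ n+1 has a cycle containing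
all vertices of S. -/
theorem S_cyclable_of_two_connected {V : Type*} [Fintype V] [DecidableEq V]
    (G : SimpleGraph V) [DecidableRel G.Adj]
    (X Y S : Finset V) (n : ℕ)
    (hdisj : Disjoint X Y) (hcover : X ∪ Y = Finset.univ)
    (hX : X.card = n) (hY : Y.card = n)
    (hbip : ∀ u v : V, G.Adj u v → (u ∈ X ∧ v ∈ Y) ∨ (u ∈ Y ∧ v ∈ X))
    (hSX : S ⊆ X)
    -- 2-connectedness: at least 3 vertices, connected, and removing any
    -- single vertex leaves a connected graph
    (hcard : 3 ≤ Fintype.card V)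
    (hconn : G.Connected)
    (h2conn : ∀ w : V, (G.induce ({w}ᶜ : Set V)).Connected)
    (hdeg : ∀ x ∈ S, ∀ y ∈ Y, ¬ G.Adj x y → n + 1 ≤ G.degree x + G.degree y) :
    ∃ (u : V) (c : G.Walk u u), c.IsCycle ∧ ∀ s ∈ S, s ∈ c.support := by
  have hG : G.IsBipartiteWith X Y :=
    ⟨Finset.disjoint_coe.2 hdisj, fun u v h ↦ by simpa using hbip u v h⟩
  rcases Nat.lt_or_ge 1 S.card with hS | hS
  · exact SimpleGraph.isCyclable_of_one_lt_card hX hY hSX hS _ G hG hdeg rfl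
  · obtain ⟨x, hx⟩ : ∃ x, ∀ s ∈ S, s = x := by
      rcases S.eq_empty_or_nonempty with rfl | ⟨x, hx⟩
      · exact ⟨hconn.nonempty.some, by simp⟩
      · exact ⟨x, fun s hs ↦ Finset.card_le_one.1 hS s hs x hx⟩
    obtain ⟨c, hc⟩ := SimpleGraph.exists_isCycle_of_connected_compl hcard h2conn x
    exact ⟨x, c, hc, fun s hs ↦ hx s hs ▸ c.start_mem_support⟩
end

section
/- For each positive even integer k there exists a balanced bipartite graph G of order 2n with n = 2k+1 and a set S equal to one full side of the bipartition, such that every nonadjacent pair x ∈ S, y in the other side satisfies d(x)+d(y) ≥ n+1, yet G does not contain k disjoint cycles covering S with each cycle containing at least two vertices of S. (Construction: S = A ∪ C ∪ {x}, Y = B ∪ D ∪ {y} with |A|=|B|=|C|=|D|=k; G[A,B] and G[C,D] complete bipartite; E(G[A,D]) a perfect matching; N(x) = B ∪ {y}, N(y) = C ∪ {x}.) -/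
open Finset

/-- Two copies of `K_{k+1,k}`, indexed by `Bool`, joined by a perfect matching between their larger
sides. -/
def matchedBicliques (k : ℕ) : SimpleGraph ((Fin (k + 1) ⊕ Fin k) × Bool) where
  Adj p q := (p.2 = q.2 ∧ p.1.isLeft ≠ q.1.isLeft) ∨ (p.2 ≠ q.2 ∧ p.1 = q.1 ∧ p.1.isLeft)
  symm := ⟨by rintro p q (⟨h, h'⟩ | ⟨h, h', h''⟩)
              · exact .inl ⟨h.symm, h'.symm⟩
              · exact .inr ⟨h.symm, h'.symm, h' ▸ h''⟩⟩
  loopless := ⟨by rintro p (⟨-, h⟩ | ⟨h, -⟩) <;> exact h rfl⟩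

namespace matchedBicliques

variable {k : ℕ}

/-- The part of `T` in the larger (`l = true`) or smaller (`l = false`) side of copy `s`. -/
def cell (T : Finset ((Fin (k + 1) ⊕ Fin k) × Bool)) (l s : Bool) :
    Finset ((Fin (k + 1) ⊕ Fin k) × Bool) :=
  {p ∈ T | p.1.isLeft = l ∧ p.2 = s}

theorem card_cell_univ_true (s : Bool) :
    #(cell (univ : Finset ((Fin (k + 1) ⊕ Fin k) × Bool)) true s) = k + 1 := by
  have : cell (univ : Finset ((Fin (k + 1) ⊕ Fin k) × Bool)) true s =
      univ.image fun a : Fin (k + 1) => (Sum.inl a, s) := by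
    ext ⟨a | b, t⟩ <;> simp [cell, @eq_comm _ s]
  rw [this, card_image_of_injective _ fun a b h => by simpa using h, card_fin]

theorem card_cell_univ_false (s : Bool) :
    #(cell (univ : Finset ((Fin (k + 1) ⊕ Fin k) × Bool)) false s) = k := by
  have : cell (univ : Finset ((Fin (k + 1) ⊕ Fin k) × Bool)) false s =
      univ.image fun b : Fin k => (Sum.inr b, s) := by
    ext ⟨a | b, t⟩ <;> simp [cell, @eq_comm _ s]
  rw [this, card_image_of_injective _ fun a b h => by simpa using h, card_fin]

theorem card_filter_isLeft_eq (T : Finset ((Fin (k + 1) ⊕ Fin k) × Bool)) :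
    #{p ∈ T | p.1.isLeft = p.2} = #(cell T true true) + #(cell T false false) := by
  have hd : Disjoint (cell T true true) (cell T false false) := by
    rw [disjoint_left]
    simp +contextual [cell]
  rw [← card_union_of_disjoint hd]
  congr 1
  ext ⟨a | b, _ | _⟩ <;> simp [cell]

theorem card_filter_isLeft_ne (T : Finset ((Fin (k + 1) ⊕ Fin k) × Bool)) :
    #{p ∈ T | p.1.isLeft ≠ p.2} = #(cell T true false) + #(cell T false true) := by
  have hd : Disjoint (cell T true false) (cell T false true) := by
    rw [disjoint_left]
    simp +contextual [cell]
  rw [← card_union_of_disjoint hd]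
  congr 1
  ext ⟨a | b, _ | _⟩ <;> simp [cell]

theorem isLeft_eq_iff_of_adj {p q : (Fin (k + 1) ⊕ Fin k) × Bool}
    (h : (matchedBicliques k).Adj p q) : p.1.isLeft = p.2 ↔ q.1.isLeft ≠ q.2 := by
  obtain ⟨a | a, _ | _⟩ := p <;> obtain ⟨b | b, _ | _⟩ := q <;> simp_all [matchedBicliques]

theorem ncard_neighborSet (p : (Fin (k + 1) ⊕ Fin k) × Bool) :
    ((matchedBicliques k).neighborSet p).ncard = k + 1 := by
  obtain ⟨a | b, s⟩ := p
  · have : (matchedBicliques k).neighborSet (Sum.inl a, s) =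
        ↑(insert (Sum.inl a, !s) (cell univ false s)) := by
      ext ⟨c | c, t⟩ <;> cases s <;> cases t <;> simp [matchedBicliques, cell, @eq_comm _ a]
    rw [this, Set.ncard_coe_finset, card_insert_of_notMem (by simp [cell]), card_cell_univ_false]
  · have : (matchedBicliques k).neighborSet (Sum.inr b, s) =
        (cell univ true s : Finset ((Fin (k + 1) ⊕ Fin k) × Bool)) := by
      ext ⟨c | c, t⟩ <;> simp [matchedBicliques, cell, @eq_comm _ s]
    rw [this, Set.ncard_coe_finset, card_cell_univ_true]

section TwoRegular

variable {T : Finset ((Fin (k + 1) ⊕ Fin k) × Bool)} {H : (matchedBicliques k).Subgraph}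

open Classical in
theorem card_filter_adj_of_ncard (hT : H.verts = T)
    (hH : ∀ p ∈ T, (H.neighborSet p).ncard = 2) {p : (Fin (k + 1) ⊕ Fin k) × Bool} (hp : p ∈ T) :
    #{q ∈ T | H.Adj p q} = 2 := by
  rw [← hH p hp, ← Set.ncard_coe_finset]
  congr 1
  ext q
  simp only [coe_filter, Set.mem_ofPred_eq, SimpleGraph.Subgraph.mem_neighborSet,
    and_iff_right_iff_imp]
  intro h
  have := h.snd_mem
  rwa [hT] at this

theorem cell_false_nonempty (hT : H.verts = T)
    (hH : ∀ p ∈ T, (H.neighborSet p).ncard = 2) {s : Bool} (h : 0 < #(cell T true s)) :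
    0 < #(cell T false s) := by
  classical
  obtain ⟨p, hp⟩ := card_pos.1 h
  have hpT : p ∈ T := (mem_filter.1 hp).1
  have hsub : {q ∈ T | H.Adj p q} ⊆ insert (p.1, !s) (cell T false s) := by
    intro q hq
    obtain ⟨hqT, hq⟩ := mem_filter.1 hq
    have := hq.adj_sub
    obtain ⟨a | a, t⟩ := p <;> obtain ⟨b | b, u⟩ := q <;> cases s <;> cases t <;> cases u <;>
      simp_all [matchedBicliques, cell]
  have h2 := (card_le_card hsub).trans (card_insert_le _ _)
  rw [card_filter_adj_of_ncard hT hH hpT] at h2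
  lia

theorem two_le_card_cell_true (hT : H.verts = T)
    (hH : ∀ p ∈ T, (H.neighborSet p).ncard = 2) {s : Bool} (h : 0 < #(cell T false s)) :
    2 ≤ #(cell T true s) := by
  classical
  obtain ⟨p, hp⟩ := card_pos.1 h
  have hpT : p ∈ T := (mem_filter.1 hp).1
  rw [← card_filter_adj_of_ncard hT hH hpT]
  refine card_le_card fun q hq => ?_
  obtain ⟨hqT, hq⟩ := mem_filter.1 hq
  have := hq.adj_sub
  obtain ⟨a | a, t⟩ := p <;> obtain ⟨b | b, u⟩ := q <;> simp_all [matchedBicliques, cell]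

theorem card_sides_eq (hT : H.verts = T) (hH : ∀ p ∈ T, (H.neighborSet p).ncard = 2) :
    #{p ∈ T | p.1.isLeft = p.2} = #{p ∈ T | p.1.isLeft ≠ p.2} := by
  classical
  suffices #{p ∈ T | p.1.isLeft = p.2} * 2 = #{p ∈ T | p.1.isLeft ≠ p.2} * 2 by lia
  refine card_mul_eq_card_mul H.Adj (fun p hp => ?_) fun p hp => ?_
  · obtain ⟨hpT, hp⟩ := mem_filter.1 hp
    rw [← card_filter_adj_of_ncard hT hH hpT, bipartiteAbove, filter_filter]
    congr 1
    refine filter_congr fun q _ => and_iff_right_of_imp fun h => ?_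
    exact (isLeft_eq_iff_of_adj h.adj_sub).1 hp
  · obtain ⟨hpT, hp⟩ := mem_filter.1 hp
    rw [← card_filter_adj_of_ncard hT hH hpT, bipartiteBelow, filter_filter]
    congr 1
    refine filter_congr fun q _ => ?_
    rw [H.adj_comm]
    exact and_iff_right_of_imp fun h => (isLeft_eq_iff_of_adj h.symm.adj_sub).2 hp

end TwoRegular

theorem sum_card_filter_le {ι α : Type*} [Fintype ι] [Fintype α] [DecidableEq α]
    {T : ι → Finset α} (hT : ∀ i j, i ≠ j → Disjoint (T i) (T j)) (P : α → Prop)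
    [DecidablePred P] : ∑ i, #{p ∈ T i | P p} ≤ #{p | P p} := by
  rw [← card_biUnion fun i _ j _ h => disjoint_filter_filter (hT i j h)]
  refine card_le_card fun p hp => ?_
  simp only [mem_biUnion, mem_filter, mem_univ, true_and] at hp ⊢
  exact hp.choose_spec.2

/-- A family of `k` disjoint two-regular subgraphs cannot cover a side of the graph with each member
meeting it at least twice, when `k` is even. -/
theorem not_exists_cover (hk : Even k) {T : Fin k → Finset ((Fin (k + 1) ⊕ Fin k) × Bool)}
    {H : Fin k → (matchedBicliques k).Subgraph} (hT : ∀ i, (H i).verts = T i)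
    (hH : ∀ i, ∀ p ∈ T i, ((H i).neighborSet p).ncard = 2)
    (hd : ∀ i j, i ≠ j → Disjoint (T i) (T j))
    (h2 : ∀ i, 2 ≤ #{p ∈ T i | p.1.isLeft = p.2})
    (hcov : ∀ p : (Fin (k + 1) ⊕ Fin k) × Bool, p.1.isLeft = p.2 → ∃ i, p ∈ T i) : False := by
  have hside : ∑ i, #{p ∈ T i | p.1.isLeft = p.2} = 2 * k + 1 := by
    rw [← card_biUnion fun i _ j _ h => disjoint_filter_filter (hd i j h)]
    have : univ.biUnion (fun i => {p ∈ T i | p.1.isLeft = p.2}) =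
        ({p | p.1.isLeft = p.2} : Finset ((Fin (k + 1) ⊕ Fin k) × Bool)) := by
      ext p
      simpa using hcov p
    rw [this, card_filter_isLeft_eq, card_cell_univ_true, card_cell_univ_false]
    lia
  have hsmall (s : Bool) : ∑ i, #(cell (T i) false s) ≤ k :=
    (sum_card_filter_le hd _).trans_eq (card_cell_univ_false s)
  have hcell (i : Fin k) :
      #{p ∈ T i | p.1.isLeft = p.2} = #(cell (T i) true true) + #(cell (T i) false false) ∧
      #{p ∈ T i | p.1.isLeft = p.2} = #(cell (T i) true false) + #(cell (T i) false true) ∧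
      ∀ s, (0 < #(cell (T i) true s) → 0 < #(cell (T i) false s)) ∧
        (0 < #(cell (T i) false s) → 2 ≤ #(cell (T i) true s)) :=
    ⟨card_filter_isLeft_eq _, (card_sides_eq (hT i) (hH i)).trans (card_filter_isLeft_ne _),
      fun s => ⟨cell_false_nonempty (hT i) (hH i), two_le_card_cell_true (hT i) (hH i)⟩⟩
  have hge (i : Fin k) : 2 ≤ #(cell (T i) false true) + #(cell (T i) false false) := by
    obtain ⟨h, h', hs⟩ := hcell i
    have := hs true
    have := hs false
    have := h2 i
    omega
  have hconst : ∑ _i : Fin k, 2 = 2 * k := by simp [mul_comm]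
  have hsum : ∑ i, (#(cell (T i) false true) + #(cell (T i) false false)) ≤ ∑ _i : Fin k, 2 := by
    rw [sum_add_distrib, hconst]
    linarith [hsmall true, hsmall false]
  have heq (i : Fin k) : 2 = #(cell (T i) false true) + #(cell (T i) false false) :=
    (sum_eq_sum_iff_of_le fun i _ => hge i).1 ((sum_le_sum fun i _ => hge i).antisymm hsum) i
      (mem_univ i)
  have htrue : ∑ i, #(cell (T i) false true) = k := by
    have : ∑ i, (#(cell (T i) false true) + #(cell (T i) false false)) = 2 * k := by
      rw [← hconst, ← sum_congr rfl fun i _ => heq i]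
    rw [sum_add_distrib] at this
    linarith [hsmall true, hsmall false]
  have hle (i : Fin k) : #{p ∈ T i | p.1.isLeft = p.2} ≤ 3 := by
    have h := sum_le_sum fun j (_ : j ∈ univ.erase i) => h2 j
    have h' := add_sum_erase univ (fun j => #{p ∈ T j | p.1.isLeft = p.2}) (mem_univ i)
    have h'' := add_sum_erase univ (fun _ : Fin k => 2) (mem_univ i)
    lia
  have hpar (i : Fin k) :
      #{p ∈ T i | p.1.isLeft = p.2} ≡ #(cell (T i) false true) [MOD 2] := by
    obtain ⟨h, h', hs⟩ := hcell i
    have := hs true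
    have := hs false
    have := h2 i
    have := hle i
    have := heq i
    unfold Nat.ModEq
    omega
  have hmod : ∑ i, #{p ∈ T i | p.1.isLeft = p.2} ≡ ∑ i, #(cell (T i) false true) [MOD 2] := by
    unfold Nat.ModEq
    rw [sum_nat_mod, sum_nat_mod univ 2 fun i => #(cell (T i) false true)]
    exact congrArg (· % 2) (sum_congr rfl fun i _ => hpar i)
  rw [hside, htrue] at hmod
  obtain ⟨m, hm⟩ := hk
  unfold Nat.ModEq at hmod
  omega

end matchedBicliques

/-- Example 1: for every positive even k there is a balanced bipartite graph G
of order 2n, n = 2k+1, with S one full side of the bipartition, satisfying the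
degree condition σ₁,₁(S) ≥ n+1 but not S-k-cyclable. This shows |S| ≥ 2k+2 is
best possible in the covering theorem. -/
theorem exists_sharpness_example (k : ℕ) (hk : 0 < k) (hke : Even k) :
    ∃ (V : Type) (G : SimpleGraph V) (X Y : Finset V),
      (Set.univ : Set V).ncard = 2 * (2 * k + 1) ∧
      Disjoint (X : Set V) (Y : Set V) ∧
      (X : Set V) ∪ (Y : Set V) = Set.univ ∧
      X.card = 2 * k + 1 ∧ Y.card = 2 * k + 1 ∧
      (∀ u v : V, G.Adj u v → (u ∈ X ∧ v ∈ Y) ∨ (u ∈ Y ∧ v ∈ X)) ∧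
      (∀ x ∈ X, ∀ y ∈ Y, ¬ G.Adj x y →
        (2 * k + 1) + 1 ≤ (G.neighborSet x).ncard + (G.neighborSet y).ncard) ∧
      ¬ ∃ (v : Fin k → V) (c : ∀ i, G.Walk (v i) (v i)),
          (∀ i, (c i).IsCycle) ∧
          (∀ i j, i ≠ j → List.Disjoint (c i).support (c j).support) ∧
          (∀ i, 2 ≤ {x : V | x ∈ X ∧ x ∈ (c i).support}.ncard) ∧
          (∀ x ∈ X, ∃ i, x ∈ (c i).support) := by
  refine ⟨(Fin (k + 1) ⊕ Fin k) × Bool, matchedBicliques k,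
    univ.filter fun p => p.1.isLeft = p.2, univ.filter fun p => p.1.isLeft ≠ p.2,
    ?_, ?_, ?_, ?_, ?_, ?_, ?_, ?_⟩
  · rw [Set.ncard_univ, Nat.card_eq_fintype_card]
    simp
    ring
  · rw [disjoint_coe]
    exact disjoint_filter_filter_not _ _ _
  · ext p
    simp [em]
  · rw [matchedBicliques.card_filter_isLeft_eq, matchedBicliques.card_cell_univ_true,
      matchedBicliques.card_cell_univ_false]
    ring
  · rw [matchedBicliques.card_filter_isLeft_ne, matchedBicliques.card_cell_univ_true,
      matchedBicliques.card_cell_univ_false]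
    ring
  · intro u v h
    have h' := matchedBicliques.isLeft_eq_iff_of_adj h
    simp only [mem_filter, mem_univ, true_and]
    tauto
  · intro x _ y _ _
    rw [matchedBicliques.ncard_neighborSet, matchedBicliques.ncard_neighborSet]
    lia
  · rintro ⟨v, c, hc, hd, h2, hcov⟩
    refine matchedBicliques.not_exists_cover hke (T := fun i => (c i).support.toFinset)
      (H := fun i => (c i).toSubgraph) (fun i => ?_) (fun i p hp => ?_) (fun i j h => ?_)
      (fun i => ?_) fun p hp => ?_
    · ext p
      simp
    · exact (hc i).ncard_neighborSet_toSubgraph_eq_two (List.mem_toFinset.1 hp)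
    · exact List.disjoint_toFinset_iff_disjoint.2 (hd i j h)
    · refine (h2 i).trans_eq ?_
      rw [← Set.ncard_coe_finset]
      congr 1
      ext p
      simp [and_comm]
    · simpa using hcov p (by simpa using hp)
end

section
/- Let G be a bipartite graph with S ⊆ X, let C be a feasible 4-cycle, and let P = u_1 u_2 ⋯ u_p be a path in G − C with |S ∩ V(P)| ≥ 3 and u_1 ∈ S, and with u_p ∉ S if |S ∩ V(P)| = 3. Define U = (S ∩ V(P)) ∪ (S ∩ V(P))^+ if u_p ∉ S, and U = (S ∩ V(P)) ∪ (S ∩ V(P − u_p))^+ if u_p ∈ S, where v^+ denotes the successor of v on P. If the number of edges from U to C is at least |U| + 1, then the induced subgraph on V(C) ∪ V(P) contains two disjoint feasible cycles. -/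
/-- `SegmentCycle e i j T` says that the positions `i ≤ j` of an alternating sequence can be closed up
to a cycle through the quadrilateral vertices `T`. Here `e i b` records whether position `i` is joined
to the quadrilateral vertex `(i.bodd, b)`. -/
inductive SegmentCycle (e : ℕ → Bool → Bool) : ℕ → ℕ → Finset (Bool × Bool) → Prop
  | single {i j : ℕ} {b : Bool} (hij : i < j) (hpar : j.bodd = i.bodd)
      (hi : e i b) (hj : e j b) : SegmentCycle e i j {(i.bodd, b)}
  | edge {i j : ℕ} {b c : Bool} (hij : i < j) (hpar : j.bodd = !i.bodd)
      (hi : e i b) (hj : e j c) : SegmentCycle e i j {(i.bodd, b), (!i.bodd, c)}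
  | path {i j : ℕ} {b : Bool} (c : Bool) (hij : i ≤ j) (hpar : j.bodd = i.bodd)
      (hi : e i b) (hj : e j !b) :
      SegmentCycle e i j {(i.bodd, b), (i.bodd, !b), (!i.bodd, c)}

theorem SegmentCycle.le {e : ℕ → Bool → Bool} {i j : ℕ} {T : Finset (Bool × Bool)}
    (h : SegmentCycle e i j T) : i ≤ j := by
  cases h <;> omega

/-- Two disjoint segments of the window `[lo, hi)` close up through disjoint vertex sets of the
quadrilateral. -/
def TwoSegmentCycles (e : ℕ → Bool → Bool) (lo hi : ℕ) : Prop :=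
  ∃ i j k l T T', lo ≤ i ∧ j < k ∧ l < hi ∧ Disjoint T T' ∧
    SegmentCycle e i j T ∧ SegmentCycle e k l T'

namespace TwoSegmentCycles

variable {e : ℕ → Bool → Bool} {lo hi : ℕ}

theorem mono {lo' hi' : ℕ} (hlo : lo ≤ lo') (hhi : hi' ≤ hi) (h : TwoSegmentCycles e lo' hi') :
    TwoSegmentCycles e lo hi := by
  obtain ⟨i, j, k, l, T, T', h₁, h₂, h₃, h⟩ := h
  exact ⟨i, j, k, l, T, T', by omega, h₂, by omega, h⟩

theorem of_segmentCycle {i j k l : ℕ} {T T' : Finset (Bool × Bool)} (h : SegmentCycle e i j T)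
    (h' : SegmentCycle e k l T') (hi₀ : lo ≤ i) (hjk : j < k) (hl : l < hi) (hd : Disjoint T T') :
    TwoSegmentCycles e lo hi :=
  ⟨i, j, k, l, T, T', hi₀, hjk, hl, hd, h, h'⟩

end TwoSegmentCycles

/-- Patterns of adjacencies of six consecutive positions that yield two disjoint cycles. -/
def sixConfig (f₀ f₁ f₂ f₃ f₄ f₅ : Bool → Bool) (b c : Bool) : Bool :=
  (f₀ b && f₁ c && f₂ !b && f₃ !c) || (f₂ b && f₃ c && f₄ !b && f₅ !c) ||
  (f₀ b && f₁ c && f₂ !b && f₄ !b) || (f₀ b && f₁ c && f₃ !c && f₅ !c) ||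
  (f₁ b && f₂ c && f₃ !b && f₅ !b) || (f₀ b && f₀ !b && f₁ c && f₃ c) ||
  (f₀ b && f₀ !b && f₁ c && f₅ c) || (f₀ b && f₀ !b && f₃ c && f₅ c) ||
  (f₁ b && f₁ !b && f₂ c && f₄ c) || (f₀ b && f₂ b && f₃ c && f₄ !b) ||
  (f₀ b && f₂ b && f₄ !b && f₅ c) || (f₁ b && f₃ b && f₄ c && f₅ !b) ||
  (f₀ b && f₂ b && f₅ c && f₅ !c) || (f₀ b && f₄ b && f₅ c && f₅ !c) ||
  (f₁ b && f₃ b && f₄ c && f₄ !c) || (f₂ b && f₄ b && f₅ c && f₅ !c) ||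
  (f₀ b && f₂ b && f₃ c && f₅ c)

/-- Patterns of adjacencies of positions `1` to `5` that yield two disjoint cycles when positions
`0` and `6` are joined to both quadrilateral vertices. -/
def sevenConfig (f₁ f₂ f₃ f₄ f₅ : Bool → Bool) (b c : Bool) : Bool :=
  (f₁ c && f₃ !c) || (f₁ c && f₅ !c) || (f₁ c && f₄ b) || (f₃ c && f₄ b) || (f₃ c && f₅ c) ||
  (f₁ c && f₂ b) || (f₂ b && f₃ c) || (f₂ b && f₅ c) || (f₄ b && f₅ c) || (f₂ b && f₄ !b)

/-- The Boolean function with prescribed values at `true` and `false`. -/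
def boolFun (a b : Bool) : Bool → Bool := fun c => bif c then a else b

theorem eq_boolFun (f : Bool → Bool) : f = boolFun (f true) (f false) := by
  funext c
  cases c <;> rfl

theorem exists_sixConfig (f₀ f₁ f₂ f₃ f₄ f₅ : Bool → Bool)
    (h : 7 ≤ (f₀ true).toNat + (f₀ false).toNat + ((f₁ true).toNat + (f₁ false).toNat) +
      ((f₂ true).toNat + (f₂ false).toNat) + ((f₃ true).toNat + (f₃ false).toNat) +
      ((f₄ true).toNat + (f₄ false).toNat) + ((f₅ true).toNat + (f₅ false).toNat)) :
    ∃ b c, sixConfig f₀ f₁ f₂ f₃ f₄ f₅ b c := by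
  have key : ∀ a₀ b₀ a₁ b₁ a₂ b₂ a₃ b₃ a₄ b₄ a₅ b₅ : Bool,
      7 ≤ a₀.toNat + b₀.toNat + (a₁.toNat + b₁.toNat) + (a₂.toNat + b₂.toNat) +
        (a₃.toNat + b₃.toNat) + (a₄.toNat + b₄.toNat) + (a₅.toNat + b₅.toNat) →
      ∃ b c, sixConfig (boolFun a₀ b₀) (boolFun a₁ b₁) (boolFun a₂ b₂) (boolFun a₃ b₃)
        (boolFun a₄ b₄) (boolFun a₅ b₅) b c := by
    decide +kernel
  rw [eq_boolFun f₀, eq_boolFun f₁, eq_boolFun f₂, eq_boolFun f₃, eq_boolFun f₄, eq_boolFun f₅]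
  exact key _ _ _ _ _ _ _ _ _ _ _ _ h

theorem exists_sevenConfig (f₁ f₂ f₃ f₄ f₅ : Bool → Bool)
    (h : 4 ≤ (f₁ true).toNat + (f₁ false).toNat +
      ((f₂ true).toNat + (f₂ false).toNat) + ((f₃ true).toNat + (f₃ false).toNat) +
      ((f₄ true).toNat + (f₄ false).toNat) + ((f₅ true).toNat + (f₅ false).toNat)) :
    ∃ b c, sevenConfig f₁ f₂ f₃ f₄ f₅ b c := by
  have key : ∀ a₁ b₁ a₂ b₂ a₃ b₃ a₄ b₄ a₅ b₅ : Bool,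
      4 ≤ a₁.toNat + b₁.toNat + (a₂.toNat + b₂.toNat) +
        (a₃.toNat + b₃.toNat) + (a₄.toNat + b₄.toNat) + (a₅.toNat + b₅.toNat) →
      ∃ b c, sevenConfig (boolFun a₁ b₁) (boolFun a₂ b₂) (boolFun a₃ b₃)
        (boolFun a₄ b₄) (boolFun a₅ b₅) b c := by
    decide +kernel
  rw [eq_boolFun f₁, eq_boolFun f₂, eq_boolFun f₃, eq_boolFun f₄, eq_boolFun f₅]
  exact key _ _ _ _ _ _ _ _ _ _ h

theorem exists_toNat_pos {f : Bool → Bool} (h : 1 ≤ (f true).toNat + (f false).toNat) :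
    ∃ b, f b := by
  rcases Bool.eq_false_or_eq_true (f true) with ht | ht
  · exact ⟨_, ht⟩
  · rcases Bool.eq_false_or_eq_true (f false) with hf | hf
    · exact ⟨_, hf⟩
    · simp [ht, hf] at h

theorem forall_of_two_le_toNat {f : Bool → Bool} (h : 2 ≤ (f true).toNat + (f false).toNat)
    (b : Bool) : f b := by
  have h₁ := (f true).toNat_le
  have h₂ := (f false).toNat_le
  cases b
  · exact Bool.toNat_eq_one.1 (by omega)
  · exact Bool.toNat_eq_one.1 (by omega)

theorem Finset.sum_range_succ_shift (w : ℕ → ℕ) (lo m : ℕ) :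
    ∑ k ∈ Finset.range (m + 1), w (lo + k) = w lo + ∑ k ∈ Finset.range m, w (lo + 1 + k) := by
  rw [Finset.sum_range_succ', add_comm]
  simp [add_assoc, add_comm 1]

namespace TwoSegmentCycles

variable {e : ℕ → Bool → Bool} {lo hi : ℕ}

theorem of_six (h : 7 ≤ ∑ k ∈ Finset.range 6, ((e (lo + k) true).toNat + (e (lo + k) false).toNat)) :
    TwoSegmentCycles e lo (lo + 6) := by
  simp only [Finset.sum_range_succ, Finset.sum_range_zero, zero_add, add_zero] at h
  obtain ⟨b, c, hbc⟩ := exists_sixConfig _ _ _ _ _ _ h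
  clear h
  simp only [sixConfig, Bool.or_eq_true, Bool.and_eq_true, or_assoc, and_assoc] at hbc
  rcases hbc with h | h | h | h | h | h | h | h | h | h | h | h | h | h | h | h | h <;>
  obtain ⟨h₁, h₂, h₃, h₄⟩ := h <;>
  first
  | refine of_segmentCycle (.edge ?_ ?_ h₁ h₂) (.edge ?_ ?_ h₃ h₄) ?_ ?_ ?_ ?_ <;>
      first | omega | (simp; done)
  | refine of_segmentCycle (.edge ?_ ?_ h₁ h₂) (.single ?_ ?_ h₃ h₄) ?_ ?_ ?_ ?_ <;>
      first | omega | (simp; done)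
  | refine of_segmentCycle (.path (!c) ?_ ?_ h₁ h₂) (.single ?_ ?_ h₃ h₄) ?_ ?_ ?_ ?_ <;>
      first | omega | simp
  | refine of_segmentCycle (.single ?_ ?_ h₁ h₂) (.edge ?_ ?_ h₃ h₄) ?_ ?_ ?_ ?_ <;>
      first | omega | (simp; done)
  | refine of_segmentCycle (.single ?_ ?_ h₁ h₂) (.path (!b) ?_ ?_ h₃ h₄) ?_ ?_ ?_ ?_ <;>
      first | omega | simp
  | refine of_segmentCycle (.single ?_ ?_ h₁ h₂) (.single ?_ ?_ h₃ h₄) ?_ ?_ ?_ ?_ <;>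
      first | omega | simp

theorem of_seven
    (h : 8 ≤ ∑ k ∈ Finset.range 7, ((e (lo + k) true).toNat + (e (lo + k) false).toNat))
    (h₀ : ∀ b, e lo b) (h₆ : ∀ b, e (lo + 6) b) : TwoSegmentCycles e lo (lo + 7) := by
  simp only [Finset.sum_range_succ, Finset.sum_range_zero, zero_add, add_zero, h₀, h₆,
    Bool.toNat_true] at h
  obtain ⟨b, c, hbc⟩ := exists_sevenConfig (e (lo + 1)) (e (lo + 2)) (e (lo + 3)) (e (lo + 4))
    (e (lo + 5)) (by omega)
  simp only [sevenConfig, Bool.or_eq_true, Bool.and_eq_true, or_assoc] at hbc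
  rcases hbc with h | h | h | h | h | h | h | h | h | h <;>
  obtain ⟨h₁, h₂⟩ := h <;>
  first
  | refine of_segmentCycle (.edge ?_ ?_ (h₀ b) h₁) (.edge ?_ ?_ h₂ (h₆ !b)) ?_ ?_ ?_ ?_ <;>
      first | omega | (simp; done)
  | refine of_segmentCycle (.edge ?_ ?_ (h₀ !b) h₁) (.single ?_ ?_ h₂ (h₆ b)) ?_ ?_ ?_ ?_ <;>
      first | omega | simp
  | refine of_segmentCycle (.path (!c) ?_ ?_ (h₀ b) (h₀ !b)) (.single ?_ ?_ h₁ h₂) ?_ ?_ ?_ ?_ <;>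
      first | omega | simp
  | refine of_segmentCycle (.single ?_ ?_ (h₀ b) h₁) (.edge ?_ ?_ h₂ (h₆ !b)) ?_ ?_ ?_ ?_ <;>
      first | omega | (simp; done)
  | refine of_segmentCycle (.single ?_ ?_ (h₀ b) h₁) (.single ?_ ?_ h₂ (h₆ !b)) ?_ ?_ ?_ ?_ <;>
      first | omega | simp

theorem of_complete_ends {k : ℕ} {b c : Bool} (h₀ : ∀ b, e lo b) (h₁ : e (lo + 1) b)
    (h₂ : e (lo + (k + 6)) c) (h₃ : ∀ b, e (lo + (k + 7)) b) :
    TwoSegmentCycles e lo (lo + (k + 8)) := by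
  cases hk : k.bodd
  · refine of_segmentCycle (.edge ?_ ?_ (h₀ !c) h₁) (.edge ?_ ?_ h₂ (h₃ !b)) ?_ ?_ ?_ ?_ <;>
      first | omega | simp [hk]
  by_cases hbc : c = b
  · subst hbc
    refine of_segmentCycle (.path (!c) ?_ ?_ (h₀ c) (h₀ !c)) (.single ?_ ?_ h₁ h₂) ?_ ?_ ?_ ?_ <;>
      first | omega | simp [hk]
  · obtain rfl : c = !b := Bool.eq_not.2 hbc
    refine of_segmentCycle (.edge ?_ ?_ (h₀ b) h₁) (.edge ?_ ?_ h₂ (h₃ !b)) ?_ ?_ ?_ ?_ <;>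
      first | omega | simp [hk]

theorem of_lt_sum (n : ℕ) : ∀ lo, n + 6 <
      ∑ k ∈ Finset.range (n + 6), ((e (lo + k) true).toNat + (e (lo + k) false).toNat) →
    TwoSegmentCycles e lo (lo + (n + 6)) := by
  induction n using Nat.strong_induction_on with | _ n ih =>
  intro lo h
  have hle (k : ℕ) : (e k true).toNat + (e k false).toNat ≤ 2 :=
    add_le_add (Bool.toNat_le _) (Bool.toNat_le _)
  have hfirst (lo m : ℕ) := Finset.sum_range_succ_shift (fun k => (e k true).toNat + (e k false).toNat) lo m
  have hlast (m : ℕ) := Finset.sum_range_succ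
    (fun k => (e (lo + k) true).toNat + (e (lo + k) false).toNat) m
  rcases n with _ | n
  · exact of_six h
  rw [show n + 1 + 6 = n + 6 + 1 by omega] at h ⊢
  have hf := hfirst lo (n + 6)
  have hl := hlast (n + 6)
  by_cases hlo : (e lo true).toNat + (e lo false).toNat ≤ 1
  · exact mono (Nat.le_succ lo) (by omega) (ih n (by omega) (lo + 1) (by omega))
  by_cases hhi : (e (lo + (n + 6)) true).toNat + (e (lo + (n + 6)) false).toNat ≤ 1
  · exact mono le_rfl (by omega) (ih n (by omega) lo (by omega))
  have h₀ := forall_of_two_le_toNat (by omega : 2 ≤ (e lo true).toNat + (e lo false).toNat)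
  have h₁ := forall_of_two_le_toNat
    (by omega : 2 ≤ (e (lo + (n + 6)) true).toNat + (e (lo + (n + 6)) false).toNat)
  rcases n with _ | n
  · exact of_seven h h₀ h₁
  rw [show n + 1 + 6 = n + 6 + 1 by omega] at *
  by_cases hlo' : (e (lo + 1) true).toNat + (e (lo + 1) false).toNat = 0
  · have := hfirst (lo + 1) (n + 6)
    have := hle lo
    exact mono (Nat.le_add_right lo (1 + 1)) (by omega)
      (ih n (by omega) (lo + 1 + 1) (by omega))
  by_cases hhi' : (e (lo + (n + 6)) true).toNat + (e (lo + (n + 6)) false).toNat = 0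
  · have := hlast (n + 6)
    have := hle (lo + (n + 6 + 1))
    exact mono le_rfl (by omega) (ih n (by omega) lo (by omega))
  obtain ⟨b, hb⟩ := exists_toNat_pos (Nat.one_le_iff_ne_zero.2 hlo')
  obtain ⟨c, hc⟩ := exists_toNat_pos (Nat.one_le_iff_ne_zero.2 hhi')
  exact of_complete_ends h₀ hb hc h₁

end TwoSegmentCycles

theorem Finset.exists_strictMonoOn_image_range (I : Finset ℕ) :
    ∃ f : ℕ → ℕ, StrictMonoOn f (Set.Iio I.card) ∧ (Finset.range I.card).image f = I := by
  have hI : (Set.ofPred (· ∈ I)).Finite := I.finite_toSet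
  have hcard : hI.toFinset.card = I.card := by
    congr 1
    ext
    simp
  refine ⟨Nat.nth (· ∈ I), hcard ▸ Nat.nth_strictMonoOn hI, ?_⟩
  ext i
  simp only [Finset.mem_image, Finset.mem_range, ← hcard]
  constructor
  · rintro ⟨k, hk, rfl⟩
    exact Nat.nth_mem_of_lt_card hI hk
  · exact fun hi => Nat.exists_lt_card_finite_nth_eq hI hi

/-- The increasing enumeration of a set of even numbers together with their successors (but possibly
without the successor of the bound `L`) alternates between the two. -/
theorem enumeration_alternates {A : Finset ℕ} {L : ℕ} (hA : ∀ i ∈ A, i.bodd = false)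
    (hAL : ∀ i ∈ A, i ≤ L) (h0 : 0 ∈ A) {n : ℕ} {f : ℕ → ℕ} (hf : StrictMonoOn f (Set.Iio n))
    (himage : (Finset.range n).image f = A ∪ (A.erase L).image (· + 1)) {k : ℕ} (hk : k < n) :
    (k.bodd = false → f k ∈ A) ∧ (k.bodd = true → ∃ m, f k = m + 1 ∧ m ∈ A) := by
  have hmem (i : ℕ) : (∃ k < n, f k = i) ↔ i ∈ A ∨ ∃ m, m ≠ L ∧ m ∈ A ∧ m + 1 = i := by
    simpa [and_assoc] using Finset.ext_iff.1 himage i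
  have hgap (k i : ℕ) (hk : k + 1 < n) (h₁ : f k < i) (h₂ : i < f (k + 1)) :
      ¬ (i ∈ A ∨ ∃ m, m ≠ L ∧ m ∈ A ∧ m + 1 = i) := by
    rw [← hmem]
    rintro ⟨l, hl, rfl⟩
    have h₁ := (hf.lt_iff_lt (Set.mem_Iio.2 (by omega)) (Set.mem_Iio.2 hl)).1 h₁
    have h₂ := (hf.lt_iff_lt (Set.mem_Iio.2 hl) (Set.mem_Iio.2 hk)).1 h₂
    omega
  induction k with
  | zero =>
    obtain ⟨l, hl, h⟩ := (hmem 0).2 (.inl h0)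
    have := hf.monotoneOn (Set.mem_Iio.2 hk) (Set.mem_Iio.2 hl) (Nat.zero_le l)
    simpa [show f 0 = 0 by omega]
  | succ k ih =>
    obtain ⟨h₁, h₂⟩ := ih (by omega)
    have hlt := hf (Set.mem_Iio.2 (by omega : k < n)) (Set.mem_Iio.2 hk) k.lt_succ_self
    have hnext := (hmem _).1 ⟨k + 1, hk, rfl⟩
    rw [Nat.bodd_succ]
    cases hp : k.bodd with
    | false =>
      have hfk := h₁ hp
      refine ⟨by simp, fun _ => ?_⟩
      rcases hnext with h | ⟨m, -, hm, h⟩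
      · have hodd : f (k + 1) ≠ f k + 1 := fun h' => by
          have := hA _ h
          rw [h', Nat.bodd_succ, hA _ hfk] at this
          simp at this
        have := hAL _ h
        exact absurd (.inr ⟨f k, by omega, hfk, rfl⟩) (hgap k (f k + 1) hk (by omega) (by omega))
      · exact ⟨m, h.symm, hm⟩
    | true =>
      obtain ⟨m', hm', hmA'⟩ := h₂ hp
      refine ⟨fun _ => ?_, by simp⟩
      rcases hnext with h | ⟨m, -, hm, h⟩
      · exact h
      · have hodd : m ≠ f k := fun h' => by
          have := hA _ hm
          rw [h', hm', Nat.bodd_succ, hA _ hmA'] at this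
          simp at this
        exact absurd (.inl hm) (hgap k m hk (by omega) (by omega))

theorem card_union_image_succ {A : Finset ℕ} (hA : ∀ i ∈ A, i.bodd = false) (L : ℕ) :
    (A ∪ (A.erase L).image (· + 1)).card = A.card + (A.erase L).card := by
  rw [Finset.card_union_of_disjoint, Finset.card_image_of_injective _ (add_left_injective 1)]
  rw [Finset.disjoint_left]
  intro i hi hi'
  obtain ⟨m, hm, rfl⟩ := Finset.mem_image.1 hi'
  have := hA _ hi
  rw [Nat.bodd_succ, hA _ (Finset.mem_of_mem_erase hm)] at this
  simp at this
section Graph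

open SimpleGraph

variable {V : Type*} {G : SimpleGraph V}

theorem SimpleGraph.Walk.IsPath.exists_isCycle_of_disjoint {a b c d : V} {q : G.Walk a b}
    {r : G.Walk c d} (hq : q.IsPath) (hr : r.IsPath) (hd : q.support.Disjoint r.support)
    (hbc : G.Adj b c) (hda : G.Adj d a) (hl : 0 < q.length ∨ 0 < r.length) :
    ∃ w : G.Walk a a, w.IsCycle ∧ ∀ x, x ∈ w.support ↔ x ∈ q.support ∨ x ∈ r.support := by
  have hc : c ∉ q.support := fun h => hd h r.start_mem_support
  have ha : a ∉ r.support := fun h => hd q.start_mem_support h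
  have haq : a ∉ q.support.tail :=
    (List.nodup_cons.1 (q.cons_tail_support ▸ hq.support_nodup)).1
  have hcr : c ∉ r.support.tail :=
    (List.nodup_cons.1 (r.cons_tail_support ▸ hr.support_nodup)).1
  refine ⟨(q.concat hbc).append (r.concat hda), (hq.concat hc hbc).isCycle_append
    (hr.concat ha hda) ?_ ?_, fun x => ?_⟩
  · simp only [Walk.support_concat,
      List.tail_append_of_ne_nil (Walk.support_ne_nil _)]
    intro x hx hx'
    simp only [List.mem_append, List.mem_singleton] at hx hx'
    rcases hx with hx | rfl <;> rcases hx' with hx' | rfl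
    · exact hd (List.mem_of_mem_tail hx) (List.mem_of_mem_tail hx')
    · exact haq hx
    · exact hcr hx'
    · exact hc q.start_mem_support
  · simpa using hl
  · simp only [Walk.mem_support_append_iff, Walk.support_concat,
      List.mem_append, List.mem_singleton]
    have := q.start_mem_support
    have := r.start_mem_support
    grind

theorem SimpleGraph.Walk.IsPath.exists_segment {u v : V} {P : G.Walk u v} (hP : P.IsPath)
    {i j : ℕ} (hij : i ≤ j) (hj : j ≤ P.length) :
    ∃ q : G.Walk (P.getVert i) (P.getVert j), q.IsPath ∧ q.length = j - i ∧
      ∀ x, x ∈ q.support ↔ ∃ k, i ≤ k ∧ k ≤ j ∧ P.getVert k = x := by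
  induction j, hij using Nat.le_induction with
  | base =>
    refine ⟨.nil, .nil, by simp, fun x => ?_⟩
    simp only [Walk.support_nil, List.mem_singleton]
    exact ⟨fun h => ⟨i, le_rfl, le_rfl, h.symm⟩, fun ⟨k, h₁, h₂, h⟩ => by
      rw [← h, le_antisymm h₁ h₂]⟩
  | succ j hij ih =>
    obtain ⟨q, hq, hlen, hqs⟩ := ih (by omega)
    refine ⟨q.concat (P.adj_getVert_succ (by omega)), hq.concat ?_ _, ?_, fun x => ?_⟩
    · rw [hqs]
      rintro ⟨k, -, hk, h⟩
      have := hP.getVert_injOn (Set.mem_ofPred.2 (by omega)) (Set.mem_ofPred.2 (by omega)) h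
      omega
    · rw [Walk.length_concat]
      omega
    · simp only [Walk.support_concat, List.mem_append, hqs,
        List.mem_singleton]
      constructor
      · rintro (⟨k, h₁, h₂, h⟩ | h)
        · exact ⟨k, h₁, by omega, h⟩
        · exact ⟨j + 1, by omega, le_rfl, h.symm⟩
      · rintro ⟨k, h₁, h₂, h⟩
        rcases Nat.lt_or_eq_of_le h₂ with h₂ | rfl
        · exact .inl ⟨k, h₁, by omega, h⟩
        · exact .inr h.symm

/-- The vertices of a feasible quadrilateral, where `cv (true, b)` runs over the vertices in `X`. -/
theorem exists_quadrilateral_labelling [DecidableEq V] {X Y S : Finset V} (hdisj : Disjoint X Y)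
    (hbip : ∀ u v : V, G.Adj u v → (u ∈ X ∧ v ∈ Y) ∨ (u ∈ Y ∧ v ∈ X)) (hSX : S ⊆ X)
    {v : V} {c : G.Walk v v} (hc : c.IsCycle) (hlen : c.length = 4)
    (hcfeas : 2 ≤ (S ∩ c.support.toFinset).card) :
    ∃ cv : Bool × Bool → V, cv.Injective ∧ (∀ b b', G.Adj (cv (false, b)) (cv (true, b'))) ∧
      (∀ b, cv (true, b) ∈ S) ∧ c.support.toFinset = Finset.univ.image cv := by
  have key : ∀ a₀ a₁ a₂ a₃ : V, G.Adj a₀ a₁ → G.Adj a₁ a₂ → G.Adj a₂ a₃ → G.Adj a₃ a₀ →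
      a₀ ≠ a₂ → a₁ ≠ a₃ → a₀ ∈ X → 2 ≤ (S ∩ {a₀, a₁, a₂, a₃}).card →
      ∃ cv : Bool × Bool → V, cv.Injective ∧ (∀ b b', G.Adj (cv (false, b)) (cv (true, b'))) ∧
        (∀ b, cv (true, b) ∈ S) ∧ {a₀, a₁, a₂, a₃} = Finset.univ.image cv := by
    intro a₀ a₁ a₂ a₃ h₀ h₁ h₂ h₃ h₀₂ h₁₃ hX hS
    have hXY := Finset.disjoint_left.1 hdisj
    have hY₁ : a₁ ∉ S := fun h => by grind
    have hY₃ : a₃ ∉ S := fun h => by grind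
    have hsub : S ∩ {a₀, a₁, a₂, a₃} ⊆ {a₀, a₂} := by
      intro x
      simp only [Finset.mem_inter, Finset.mem_insert, Finset.mem_singleton]
      grind
    have heq := Finset.eq_of_subset_of_card_le hsub (by rwa [Finset.card_pair h₀₂])
    have hS₀₂ : {a₀, a₂} ⊆ S := heq ▸ Finset.inter_subset_left
    have hS₀ : a₀ ∈ S := hS₀₂ (by simp)
    have hS₂ : a₂ ∈ S := hS₀₂ (by simp)
    refine ⟨fun t => bif t.1 then bif t.2 then a₀ else a₂ else bif t.2 then a₁ else a₃,
      ?_, ?_, ?_, ?_⟩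
    · rintro ⟨_ | _, _ | _⟩ ⟨_ | _, _ | _⟩ <;> simp <;> grind
    · rintro (_ | _) (_ | _) <;> simp [h₁, h₃, h₀.symm, h₂.symm]
    · rintro (_ | _) <;> simpa
    · ext x
      simp
      grind
  match c, hlen with
  | .cons (v := a₁) h₀ (.cons (v := a₂) h₁ (.cons (v := a₃) h₂ (.cons h₃ .nil))), _ =>
    have hnd := hc.support_nodup
    have hs : (Walk.cons h₀ (.cons h₁ (.cons h₂ (.cons h₃ .nil)))).support.toFinset =
        {v, a₁, a₂, a₃} := by
      ext
      simp
      tauto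
    have hs' : ({v, a₁, a₂, a₃} : Finset V) = {a₁, a₂, a₃, v} := by
      ext
      simp
      tauto
    rw [hs] at hcfeas ⊢
    simp at hnd
    rcases hbip _ _ h₀ with h | h
    · exact key _ _ _ _ h₀ h₁ h₂ h₃ (by tauto) (by tauto) h.1 hcfeas
    · rw [hs'] at hcfeas ⊢
      exact key _ _ _ _ h₁ h₂ h₃ h₀ (by tauto) (by tauto) h.2 hcfeas

theorem SimpleGraph.Walk.IsPath.exists_isCycle_of_segment {u v c d : V} {P : G.Walk u v}
    (hP : P.IsPath) {i j : ℕ} (hij : i ≤ j) (hj : j ≤ P.length) {r : G.Walk c d} (hr : r.IsPath)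
    (hd : ∀ k, P.getVert k ∉ r.support) (hjc : G.Adj (P.getVert j) c)
    (hdi : G.Adj d (P.getVert i)) (hl : i < j ∨ 0 < r.length) :
    ∃ (w : V) (q : G.Walk w w), q.IsCycle ∧
      ∀ x, x ∈ q.support ↔ (∃ k, i ≤ k ∧ k ≤ j ∧ P.getVert k = x) ∨ x ∈ r.support := by
  obtain ⟨q, hq, hlen, hqs⟩ := hP.exists_segment hij hj
  obtain ⟨w, hw, hws⟩ := hq.exists_isCycle_of_disjoint hr
    (fun x hx => by obtain ⟨k, -, -, rfl⟩ := (hqs x).1 hx; exact hd k) hjc hdi (by omega)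
  exact ⟨_, w, hw, fun x => by rw [hws, hqs]⟩

theorem SegmentCycle.exists_isCycle [DecidableEq V] {S : Finset V} {cv : Bool × Bool → V}
    (hinj : cv.Injective) (hadj : ∀ b c, G.Adj (cv (false, b)) (cv (true, c)))
    (hcvS : ∀ b, cv (true, b) ∈ S) {u v : V} {P : G.Walk u v} (hP : P.IsPath)
    (hPC : ∀ k t, P.getVert k ≠ cv t) {f : ℕ → ℕ} {e : ℕ → Bool → Bool} {i j : ℕ}
    {T : Finset (Bool × Bool)} (h : SegmentCycle e i j T) (hf : i < j → f i < f j)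
    (hL : f j ≤ P.length) (heven : ∀ k ≤ j, k.bodd = false → P.getVert (f k) ∈ S)
    (hodd : ∀ k ≤ j, k.bodd = true → ∃ m, f k = m + 1 ∧ P.getVert m ∈ S)
    (he : ∀ k ≤ j, ∀ b, e k b → G.Adj (P.getVert (f k)) (cv (k.bodd, b))) :
    ∃ (w : V) (q : G.Walk w w), q.IsCycle ∧ 2 ≤ (S ∩ q.support.toFinset).card ∧
      ∀ x ∈ q.support, (∃ k, f i ≤ k ∧ k ≤ f j ∧ P.getVert k = x) ∨ ∃ t ∈ T, cv t = x := by
  have hadj' : ∀ p b c, G.Adj (cv (p, b)) (cv (!p, c)) := by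
    rintro (_ | _) b c
    exacts [hadj b c, (hadj c b).symm]
  have hij := h.le
  have hfij : f i ≤ f j := by
    rcases hij.eq_or_lt with rfl | h
    exacts [le_rfl, (hf h).le]
  have close : ∀ {c d : V} (r : G.Walk c d), r.IsPath → (∀ x ∈ r.support, ∃ t ∈ T, cv t = x) →
      G.Adj (P.getVert (f j)) c → G.Adj d (P.getVert (f i)) → (i < j ∨ 0 < r.length) →
      (∃ x ∈ S, ∃ y ∈ S, x ≠ y ∧ ∀ z, z = x ∨ z = y →
        (∃ k, f i ≤ k ∧ k ≤ f j ∧ P.getVert k = z) ∨ z ∈ r.support) →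
      ∃ (w : V) (q : G.Walk w w), q.IsCycle ∧ 2 ≤ (S ∩ q.support.toFinset).card ∧
        ∀ x ∈ q.support, (∃ k, f i ≤ k ∧ k ≤ f j ∧ P.getVert k = x) ∨ ∃ t ∈ T, cv t = x := by
    rintro c d r hr hrT hjc hdi hl ⟨x, hx, y, hy, hxy, hmem⟩
    obtain ⟨w, q, hq, hqs⟩ := hP.exists_isCycle_of_segment hfij hL hr
      (fun k hk => by obtain ⟨t, -, ht⟩ := hrT _ hk; exact hPC k t ht.symm) hjc hdi
      (hl.imp_left hf)
    refine ⟨w, q, hq, Finset.one_lt_card.2 ⟨x, ?_, y, ?_, hxy⟩,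
      fun x hx => ((hqs x).1 hx).imp_right (hrT x)⟩
    · simpa [hx, hqs] using hmem x (.inl rfl)
    · simpa [hy, hqs] using hmem y (.inr rfl)
  have hne : ∀ {k l : ℕ}, k < l → l ≤ P.length → P.getVert k ≠ P.getVert l := fun hkl hl h =>
    hkl.ne (hP.getVert_injOn (Set.mem_ofPred.2 (by omega)) (Set.mem_ofPred.2 hl) h)
  cases h with
  | @single b hij' hpar hi hj =>
    have hi' := he i hij _ hi
    have hj' := he j le_rfl _ hj
    rw [hpar] at hj'
    refine close (.nil : G.Walk (cv (i.bodd, b)) _) .nil (by simp) hj' hi'.symm (.inl hij') ?_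
    cases hp : i.bodd with
    | false =>
      refine ⟨_, heven i hij hp, _, heven j le_rfl (hpar.trans hp), hne (hf hij') hL, ?_⟩
      rintro z (rfl | rfl)
      exacts [.inl ⟨_, le_rfl, hfij, rfl⟩, .inl ⟨_, hfij, le_rfl, rfl⟩]
    | true =>
      obtain ⟨m, hm, hmS⟩ := hodd j le_rfl (hpar.trans hp)
      refine ⟨_, hmS, _, hcvS b, hPC _ _, ?_⟩
      have := hf hij'
      rintro z (rfl | rfl)
      exacts [.inl ⟨_, by omega, by omega, rfl⟩, .inr (by simp)]
  | @edge b c hij' hpar hi hj =>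
    have hi' := he i hij _ hi
    have hj' := he j le_rfl _ hj
    rw [hpar] at hj'
    refine close (.cons (hadj' i.bodd b c).symm .nil) ?_ (by simp) hj' hi'.symm (.inl hij') ?_
    · simpa using (hadj' i.bodd b c).ne'
    cases hp : i.bodd with
    | false =>
      refine ⟨_, heven i hij hp, _, hcvS c, hPC _ _, ?_⟩
      rintro z (rfl | rfl)
      exacts [.inl ⟨_, le_rfl, hfij, rfl⟩, .inr (by simp)]
    | true =>
      refine ⟨_, heven j le_rfl (by simp [hpar, hp]), _, hcvS b, hPC _ _, ?_⟩
      rintro z (rfl | rfl)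
      exacts [.inl ⟨_, hfij, le_rfl, rfl⟩, .inr (by simp)]
  | @path b c _ hpar hi hj =>
    have hi' := he i hij _ hi
    have hj' := he j le_rfl _ hj
    rw [hpar] at hj'
    refine close (.cons (hadj' i.bodd (!b) c) (.cons (hadj' i.bodd b c).symm .nil)) ?_ (by simp)
      hj' hi'.symm (.inr (by simp)) ?_
    · simp [(hadj' i.bodd b c).ne', (hadj' i.bodd (!b) c).ne, hinj.eq_iff]
    cases hp : i.bodd with
    | false =>
      refine ⟨_, heven i hij hp, _, hcvS c, hPC _ _, ?_⟩
      rintro z (rfl | rfl)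
      exacts [.inl ⟨_, le_rfl, hfij, rfl⟩, .inr (by simp)]
    | true =>
      refine ⟨_, hcvS b, _, hcvS (!b), by simp [hinj.eq_iff], ?_⟩
      rintro z (rfl | rfl) <;> exact .inr (by simp)

theorem card_filter_univ_bool (g : Bool → Bool) :
    (Finset.univ.filter fun b => g b = true).card = (g true).toNat + (g false).toNat := by
  rw [Finset.card_filter, Fintype.sum_bool]
  cases g true <;> cases g false <;> rfl

theorem SimpleGraph.Walk.getVert_mem_of_bodd {X Y : Finset V} (hdisj : Disjoint X Y)
    (hbip : ∀ u v : V, G.Adj u v → (u ∈ X ∧ v ∈ Y) ∨ (u ∈ Y ∧ v ∈ X)) {u v : V}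
    (P : G.Walk u v) (hu : u ∈ X) {i : ℕ} (hi : i ≤ P.length) :
    (i.bodd = false → P.getVert i ∈ X) ∧ (i.bodd = true → P.getVert i ∈ Y) := by
  have hXY := Finset.disjoint_left.1 hdisj
  induction i with
  | zero => simpa
  | succ i ih =>
    obtain ⟨h₁, h₂⟩ := ih (by omega)
    have := hbip _ _ (P.adj_getVert_succ hi)
    cases hp : i.bodd <;> simp only [Nat.bodd_succ, hp] <;> grind

theorem SimpleGraph.Walk.IsPath.eq_getVert_succ_of_mem_darts {u v x : V} {P : G.Walk u v}
    (hP : P.IsPath) {i : ℕ} (hi : i < P.length)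
    (h : ∃ d ∈ P.darts, d.toProd = (P.getVert i, x)) : x = P.getVert (i + 1) := by
  obtain ⟨d, hd, hdx⟩ := h
  obtain ⟨k, hk, rfl⟩ := List.getElem_of_mem hd
  rw [Walk.darts_getElem_eq_getVert, Prod.mk.injEq] at hdx
  rw [Walk.length_darts] at hk
  obtain rfl := hP.getVert_injOn (Set.mem_ofPred.2 hk.le) (Set.mem_ofPred.2 hi.le) hdx.1
  exact hdx.2.symm

end Graph

/-- Lemma 3: let C be a feasible quadrilateral and P = u₁⋯u_p a disjoint path
with |S ∩ V(P)| ≥ 3, u₁ ∈ S, and u_p ∉ S if |S ∩ V(P)| = 3. With U as in the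
paper (S-vertices of P together with their successors, omitting the successor
of u_p when u_p ∈ S), if e(U, C) ≥ |U| + 1 then G[V(C) ∪ V(P)] contains two
disjoint feasible cycles. -/
theorem quad_plus_path_S_two_feasible {V : Type*} [Fintype V] [DecidableEq V]
    (G : SimpleGraph V) [DecidableRel G.Adj]
    (X Y S : Finset V)
    (hdisj : Disjoint X Y) (hcover : X ∪ Y = Finset.univ)
    (hbip : ∀ u v : V, G.Adj u v → (u ∈ X ∧ v ∈ Y) ∨ (u ∈ Y ∧ v ∈ X))
    (hSX : S ⊆ X)
    (v : V) (c : G.Walk v v) (hc : c.IsCycle) (hlen : c.length = 4)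
    (hcfeas : 2 ≤ (S ∩ c.support.toFinset).card)
    (u₁ up : V) (P : G.Walk u₁ up) (hP : P.IsPath)
    (hPC : Disjoint P.support.toFinset c.support.toFinset)
    (hSP : 3 ≤ (S ∩ P.support.toFinset).card)
    (hu₁ : u₁ ∈ S)
    (hup : (S ∩ P.support.toFinset).card = 3 → up ∉ S)
    -- σ is the successor map along P
    (σ : V → V)
    (hσ : ∀ u ∈ P.support, u ≠ up → ∃ d ∈ P.darts, d.toProd = (u, σ u))
    (U : Finset V)
    (hU : U = if up ∈ S then
        (S ∩ P.support.toFinset) ∪ ((S ∩ P.support.toFinset).erase up).image σ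
      else
        (S ∩ P.support.toFinset) ∪ (S ∩ P.support.toFinset).image σ)
    (he : U.card + 1 ≤ ∑ w ∈ U,
        (c.support.toFinset.filter (fun u => G.Adj w u)).card) :
    ∃ (w₁ w₂ : V) (c₁ : G.Walk w₁ w₁) (c₂ : G.Walk w₂ w₂),
      c₁.IsCycle ∧ c₂.IsCycle ∧
      2 ≤ (S ∩ c₁.support.toFinset).card ∧
      2 ≤ (S ∩ c₂.support.toFinset).card ∧
      c₁.support.toFinset ⊆ c.support.toFinset ∪ P.support.toFinset ∧
      c₂.support.toFinset ⊆ c.support.toFinset ∪ P.support.toFinset ∧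
      List.Disjoint c₁.support c₂.support := by
  have hXY := Finset.disjoint_left.1 hdisj
  obtain ⟨cv, hinj, hadj, hcvS, hcv⟩ := exists_quadrilateral_labelling hdisj hbip hSX hc hlen hcfeas
  have hpinj : Set.InjOn P.getVert {i | i ≤ P.length} := hP.getVert_injOn
  have hpar := fun {i} => P.getVert_mem_of_bodd hdisj hbip (hSX hu₁) (i := i)
  set A := (Finset.range (P.length + 1)).filter (P.getVert · ∈ S) with hA
  have hmemA (i : ℕ) : i ∈ A ↔ i ≤ P.length ∧ P.getVert i ∈ S := by simp [hA]
  have hSA : S ∩ P.support.toFinset = A.image P.getVert := by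
    ext x
    simp only [Finset.mem_inter, List.mem_toFinset, SimpleGraph.Walk.mem_support_iff_exists_getVert,
      Finset.mem_image, hmemA]
    grind
  have hAeven : ∀ i ∈ A, i.bodd = false := fun i hi => by
    rw [hmemA] at hi
    by_contra h
    exact hXY (hSX hi.2) ((hpar hi.1).2 (by simpa using h))
  have hAinj : Set.InjOn P.getVert A := hpinj.mono fun i hi => ((hmemA i).1 hi).1
  set I := A ∪ (A.erase P.length).image (· + 1) with hI
  have hIle : ∀ i ∈ I, i ≤ P.length := by
    intro i hi
    simp only [hI, Finset.mem_union, Finset.mem_image, Finset.mem_erase, hmemA] at hi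
    grind
  have herase : (A.image P.getVert).erase up = (A.erase P.length).image P.getVert := by
    ext x
    simp only [Finset.mem_erase, Finset.mem_image, hmemA]
    constructor
    · rintro ⟨hx, i, hi, rfl⟩
      exact ⟨i, ⟨fun h => hx (by rw [h, P.getVert_length]), hi⟩, rfl⟩
    · rintro ⟨i, ⟨hne, hi⟩, rfl⟩
      refine ⟨fun h => hne (hpinj hi.1 (Set.mem_ofPred.2 le_rfl) ?_), i, hi, rfl⟩
      rw [h, P.getVert_length]
  have hσA : ((A.erase P.length).image P.getVert).image σ =
      ((A.erase P.length).image (· + 1)).image P.getVert := by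
    rw [Finset.image_image, Finset.image_image]
    refine Finset.image_congr fun i hi => ?_
    simp only [Finset.coe_erase, Set.mem_sdiff, Finset.mem_coe, hmemA, Set.mem_singleton_iff] at hi
    refine hP.eq_getVert_succ_of_mem_darts (by omega)
      (hσ _ (P.getVert_mem_support i) fun h => hi.2 (hpinj hi.1.1 (Set.mem_ofPred.2 le_rfl) ?_))
    rw [h, P.getVert_length]
  have hUI : U = I.image P.getVert := by
    rw [hI, Finset.image_union, ← hσA, ← herase, ← hSA, hU]
    split_ifs with h
    · rfl
    · rw [Finset.erase_eq_of_notMem fun h' => h (Finset.mem_inter.1 h').1]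
  have hIinj : Set.InjOn P.getVert I := hpinj.mono hIle
  have hcardA : (S ∩ P.support.toFinset).card = A.card := by
    rw [hSA, Finset.card_image_of_injOn hAinj]
  have hn : 6 ≤ I.card := by
    rw [hI, card_union_image_succ hAeven]
    by_cases h : P.length ∈ A
    · have hS : up ∈ S := by simpa using ((hmemA _).1 h).2
      have : A.card ≠ 3 := fun h => hup (hcardA.trans h) hS
      rw [Finset.card_erase_of_mem h]
      omega
    · rw [Finset.erase_eq_of_notMem h]
      omega
  obtain ⟨f, hfmono, hfI⟩ := I.exists_strictMonoOn_image_range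
  have halt := fun {k} => enumeration_alternates hAeven (fun i hi => ((hmemA i).1 hi).1)
    ((hmemA 0).2 ⟨Nat.zero_le _, by simpa⟩) hfmono hfI (k := k)
  have hfle (k : ℕ) (hk : k < I.card) : f k ≤ P.length :=
    hIle _ (hfI ▸ Finset.mem_image_of_mem f (Finset.mem_range.2 hk))
  let e : ℕ → Bool → Bool := fun k b => decide (G.Adj (P.getVert (f k)) (cv (k.bodd, b)))
  have hnbr (k : ℕ) (hk : k < I.card) :
      (c.support.toFinset.filter (fun u => G.Adj (P.getVert (f k)) u)).card ≤
        (e k true).toNat + (e k false).toNat := by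
    rw [← card_filter_univ_bool]
    refine (Finset.card_le_card ?_).trans
      (Finset.card_image_le (f := fun b => cv (k.bodd, b)))
    intro x hx
    rw [Finset.mem_filter, hcv] at hx
    obtain ⟨hx, hkx⟩ := hx
    obtain ⟨⟨p, b⟩, -, rfl⟩ := Finset.mem_image.1 hx
    obtain rfl : p = k.bodd := by
      have h₁ := hbip _ _ hkx
      have h₂ := hbip _ _ (hadj b b)
      have h₃ := hSX (hcvS b)
      obtain ⟨h₄, h₅⟩ := halt hk
      cases p <;> cases hp : k.bodd <;> try rfl
      · obtain ⟨m, hm, hmA⟩ := h₅ hp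
        have := (hpar (hfle k hk)).2 (by rw [hm, Nat.bodd_succ, hAeven m hmA]; rfl)
        grind
      · have := hSX ((hmemA _).1 (h₄ hp)).2
        grind
    exact Finset.mem_image.2 ⟨b, by simpa [e] using hkx, rfl⟩
  have hsum : I.card + 1 ≤
      ∑ k ∈ Finset.range I.card, ((e k true).toNat + (e k false).toNat) := by
    have hfinj : Set.InjOn f (Finset.range I.card) := fun k hk l hl h =>
      hfmono.injOn (by simpa using hk) (by simpa using hl) h
    rw [hUI, Finset.card_image_of_injOn hIinj, Finset.sum_image hIinj] at he
    refine he.trans ?_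
    rw [← Finset.sum_congr hfI fun _ _ => rfl, Finset.sum_image hfinj]
    exact Finset.sum_le_sum fun k hk => hnbr k (Finset.mem_range.1 hk)
  obtain ⟨i, j, k, l, T, T', -, hjk, hl, hTT', h, h'⟩ : TwoSegmentCycles e 0 I.card := by
    obtain ⟨n, hn⟩ := Nat.exists_eq_add_of_le' hn
    rw [hn] at hsum ⊢
    have := TwoSegmentCycles.of_lt_sum (e := e) n 0 (by simpa using hsum)
    rwa [zero_add] at this
  have hPcv (k : ℕ) (t : Bool × Bool) : P.getVert k ≠ cv t := fun h =>
    Finset.disjoint_left.1 hPC (List.mem_toFinset.2 (P.getVert_mem_support k))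
      (by rw [hcv, h]; exact Finset.mem_image_of_mem cv (Finset.mem_univ t))
  have hcycle {i j : ℕ} {T : Finset (Bool × Bool)} (hj : j < I.card) (h : SegmentCycle e i j T) :=
    h.exists_isCycle hinj hadj hcvS hP hPcv
      (fun hij => hfmono (Set.mem_Iio.2 (by omega)) (Set.mem_Iio.2 hj) hij) (hfle j hj)
      (fun k hk hp => ((hmemA _).1 ((halt (by omega)).1 hp)).2)
      (fun k hk hp => by
        obtain ⟨m, hm, hmA⟩ := (halt (by omega)).2 hp
        exact ⟨m, hm, ((hmemA m).1 hmA).2⟩)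
      (fun k _ b hkb => of_decide_eq_true hkb)
  have hsub {w : V} {q : G.Walk w w} {a b : ℕ} {T : Finset (Bool × Bool)}
      (hq : ∀ x ∈ q.support, (∃ k, a ≤ k ∧ k ≤ b ∧ P.getVert k = x) ∨ ∃ t ∈ T, cv t = x) :
      q.support.toFinset ⊆ c.support.toFinset ∪ P.support.toFinset := by
    intro x hx
    rw [Finset.mem_union, hcv]
    rcases hq x (List.mem_toFinset.1 hx) with ⟨k, -, -, rfl⟩ | ⟨t, -, rfl⟩
    · exact .inr (List.mem_toFinset.2 (P.getVert_mem_support k))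
    · exact .inl (Finset.mem_image_of_mem cv (Finset.mem_univ t))
  have hkl := h'.le
  have hfjk : f j < f k := hfmono (Set.mem_Iio.2 (by omega)) (Set.mem_Iio.2 (by omega)) hjk
  have hfl := hfle l hl
  obtain ⟨w₁, c₁, hc₁, hS₁, hm₁⟩ := hcycle (by omega) h
  obtain ⟨w₂, c₂, hc₂, hS₂, hm₂⟩ := hcycle hl h'
  refine ⟨w₁, w₂, c₁, c₂, hc₁, hc₂, hS₁, hS₂, hsub hm₁, hsub hm₂, fun x hx₁ hx₂ => ?_⟩
  rcases hm₁ x hx₁ with ⟨a, -, ha, rfl⟩ | ⟨t, ht, rfl⟩ <;>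
    rcases hm₂ _ hx₂ with ⟨a', ha₁, ha₂, h⟩ | ⟨t', ht', h⟩
  · have := hpinj (Set.mem_ofPred.2 (by omega)) (Set.mem_ofPred.2 (by omega)) h
    omega
  · exact hPcv _ _ h.symm
  · exact hPcv _ _ h
  · exact Finset.disjoint_left.1 hTT' ht (hinj h ▸ ht')
end
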